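/- Let n, m, k be natural numbers with k > 0 and 2m > 3(n+1), and let X be a compact metric space of covering dimension at most n. Then X admits a topological embedding into ℝ^m if and only if the k-fold unreduced suspension Σ^k X admits a topological embedding into ℝ^{m+k}. -/

import Mathlib

open Topology Metric unitInterval

/-- Covering dimension at most `n`: every open cover admits an open refinement in which
each point lies in at most `n+1` members. -/
def CoveringDimLE (X : Type*) [TopologicalSpace X] (n : ℕ) : Prop :=
  ∀ U : Set (Set X), (∀ u ∈ U, IsOpen u) → ⋃₀ U = Set.univ →
    ∃ V : Set (Set X), (∀ v ∈ V, IsOpen v) ∧ ⋃₀ V = Set.univ ∧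
      (∀ v ∈ V, ∃ u ∈ U, v ⊆ u) ∧
      ∀ x : X, {v ∈ V | x ∈ v}.Finite ∧ {v ∈ V | x ∈ v}.ncard ≤ n + 1

lemma uiZeroNeOne : (0 : unitInterval) ≠ 1 := fun h =>
  zero_ne_one (α := ℝ) (congrArg Subtype.val h)

/-- The relation on `X × [0,1]` generating the unreduced suspension. -/
def suspRel (X : Type*) (a b : X × unitInterval) : Prop :=
  a = b ∨ (a.2 = 0 ∧ b.2 = 0) ∨ (a.2 = 1 ∧ b.2 = 1)

theorem suspRel_equivalence (X : Type*) : Equivalence (suspRel X) := by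
  constructor
  · exact fun a => Or.inl rfl
  · rintro a b (rfl | ⟨h1, h2⟩ | ⟨h1, h2⟩)
    · exact Or.inl rfl
    · exact Or.inr (Or.inl ⟨h2, h1⟩)
    · exact Or.inr (Or.inr ⟨h2, h1⟩)
  · rintro a b c (rfl | ⟨h1, h2⟩ | ⟨h1, h2⟩) hbc
    · exact hbc
    · rcases hbc with rfl | ⟨g1, g2⟩ | ⟨g1, g2⟩
      · exact Or.inr (Or.inl ⟨h1, h2⟩)
      · exact Or.inr (Or.inl ⟨h1, g2⟩)
      · exact absurd (h2.symm.trans g1) uiZeroNeOne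
    · rcases hbc with rfl | ⟨g1, g2⟩ | ⟨g1, g2⟩
      · exact Or.inr (Or.inr ⟨h1, h2⟩)
      · exact absurd (g1.symm.trans h2) (fun h => uiZeroNeOne h)
      · exact Or.inr (Or.inr ⟨h1, g2⟩)

def suspSetoid (X : Type*) : Setoid (X × unitInterval) :=
  ⟨suspRel X, suspRel_equivalence X⟩

/-- The unreduced suspension of a space: `X × [0,1]` with `X × {0}` collapsed to one
point and `X × {1}` to another. -/
def Susp (X : Type u) : Type u := Quotient (suspSetoid X)

instance instTopSusp (X : Type u) [TopologicalSpace X] : TopologicalSpace (Susp X) :=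
  inferInstanceAs (TopologicalSpace (Quotient (suspSetoid X)))

/-- The `k`-fold iterated unreduced suspension. -/
def SuspN (X : Type u) : ℕ → Type u
  | 0 => X
  | k + 1 => Susp (SuspN X k)

instance instTopSuspN (X : Type u) [TopologicalSpace X] :
    ∀ k : ℕ, TopologicalSpace (SuspN X k)
  | 0 => inferInstanceAs (TopologicalSpace X)
  | k + 1 =>
    letI := instTopSuspN X k
    inferInstanceAs (TopologicalSpace (Susp (SuspN X k)))

set_option linter.unusedSectionVars false

/-- Every compact fibre structure of `Y` is approximated by maps into a finite union of
`C¹` images of `ℝ^d`. -/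
def DimProp (Y : Type*) [TopologicalSpace Y] (d : ℕ) : Prop :=
  ∀ U : Set (Y × Y), IsOpen U → (∀ y, (y, y) ∈ U) →
    ∃ (N : ℕ) (φ : C(Y, Fin N → ℝ)) (ι : Type) (_ : Finite ι)
      (A : ι → (Fin d → ℝ) → (Fin N → ℝ)), (∀ i, ContDiff ℝ 1 (A i)) ∧
      (∀ y, ∃ i, φ y ∈ Set.range (A i)) ∧ ∀ y y', φ y = φ y' → (y, y') ∈ U

theorem isOpen_forall_mem_of_isCompact {A B : Type*} [TopologicalSpace A] [TopologicalSpace B]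
    {K : Set B} (hK : IsCompact K) {U : Set (A × B)} (hU : IsOpen U) :
    IsOpen {a | ∀ b ∈ K, (a, b) ∈ U} := by
  rw [isOpen_iff_mem_nhds]
  intro a ha
  exact hK.eventually_forall_of_forall_eventually (P := fun a b => (a, b) ∈ U)
    fun b hb => hU.mem_nhds (ha b hb)

theorem isOpen_forall_of_compactSpace {A B : Type*} [TopologicalSpace A] [TopologicalSpace B]
    [CompactSpace B] {U : Set (A × B)} (hU : IsOpen U) : IsOpen {a | ∀ b, (a, b) ∈ U} := by
  simpa using isOpen_forall_mem_of_isCompact isCompact_univ hU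

theorem dense_avoid {Y V ι : Type*} {d p q N : ℕ} [Finite ι] [NormedAddCommGroup V]
    [NormedSpace ℝ V] [FiniteDimensional ℝ V] {φ : Y → Fin N → ℝ}
    {A : ι → (Fin d → ℝ) → (Fin N → ℝ)} (hA : ∀ i, ContDiff ℝ 1 (A i))
    (hφ : ∀ y, ∃ i, φ y ∈ Set.range (A i))
    {g : (Fin p → Fin N → ℝ) × (Fin q → ℝ) → V} (hg : ContDiff ℝ 1 g)
    (hlt : p * d + q < Module.finrank ℝ V) :
    Dense {ζ | ∀ (x : Fin p → Y) (τ : Fin q → ℝ), ζ ≠ g (fun l => φ (x l), τ)} := by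
  let h : (Fin p → ι) → (Fin p → Fin d → ℝ) × (Fin q → ℝ) → V :=
    fun a bt => g (fun l => A (a l) (bt.1 l), bt.2)
  have hh : ∀ a, ContDiff ℝ 1 (h a) := by
    intro a
    refine hg.comp (ContDiff.prodMk ?_ contDiff_snd)
    refine contDiff_pi.2 fun l => (hA (a l)).comp ?_
    exact (contDiff_apply ℝ (Fin d → ℝ) l).comp contDiff_fst
  have hd : dimH (⋃ a, Set.range (h a)) < Module.finrank ℝ V := by
    rw [dimH_iUnion]
    refine lt_of_le_of_lt (iSup_le fun a => (hh a).dimH_range_le) ?_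
    have : Module.finrank ℝ ((Fin p → Fin d → ℝ) × (Fin q → ℝ)) = p * d + q := by
      simp [Module.finrank_pi_fintype]
    rw [this]
    exact_mod_cast hlt
  refine (dense_compl_of_dimH_lt_finrank hd).mono ?_
  intro ζ hζ x τ he
  apply hζ
  choose a b hab using fun l => hφ (x l)
  refine Set.mem_iUnion.2 ⟨a, ⟨(b, τ), ?_⟩⟩
  simp only [h, hab]
  exact he.symm

open Manifold in
theorem exists_contDiff_approx {Z G E : Type*} [TopologicalSpace Z] [CompactSpace Z]
    [NormedAddCommGroup G] [NormedSpace ℝ G] [FiniteDimensional ℝ G]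
    [NormedAddCommGroup E] [NormedSpace ℝ E]
    {θ : Z → G} (hθ : Continuous θ) {f : Z → E} (hf : Continuous f) {δ : ℝ}
    (h : ∀ z z', θ z = θ z' → ‖f z - f z'‖ < δ) :
    ∃ ψ : G → E, ContDiff ℝ 1 ψ ∧ ∀ z, ‖ψ (θ z) - f z‖ < δ := by
  have key := exists_contMDiffMap_forall_mem_convex_of_local_const (n := 1) 𝓘(ℝ, G)
    (t := fun x : G => {v : E | ∀ z, θ z = x → ‖v - f z‖ < δ}) ?_ ?_
  · obtain ⟨g, hg⟩ := key
    exact ⟨g, g.contMDiff.contDiff, fun z => hg (θ z) z rfl⟩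
  · intro x
    have : {v : E | ∀ z, θ z = x → ‖v - f z‖ < δ} = ⋂ z, ⋂ (_ : θ z = x), ball (f z) δ := by
      ext v; simp [dist_eq_norm]
    rw [this]
    exact convex_iInter fun z => convex_iInter fun _ => convex_ball _ _
  · intro x
    by_cases hx : ∃ z, θ z = x
    · obtain ⟨z₀, rfl⟩ := hx
      refine ⟨f z₀, ?_⟩
      have hU : IsOpen {xz : G × Z | θ xz.2 ≠ xz.1 ∨ ‖f z₀ - f xz.2‖ < δ} := by
        apply IsOpen.union
        · exact isOpen_ne_fun (hθ.comp continuous_snd) continuous_fst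
        · exact isOpen_lt (continuous_const.sub (hf.comp continuous_snd)).norm continuous_const
      have := (isOpen_forall_of_compactSpace hU).mem_nhds (x := θ z₀) (by
        intro z
        by_cases hz : θ z = θ z₀
        · exact Or.inr (h _ _ hz.symm)
        · exact Or.inl hz)
      filter_upwards [this] with y hy z hz
      exact (hy z).resolve_left (fun hn => hn hz)
    · refine ⟨0, ?_⟩
      have hc : IsClosed (Set.range θ) := (isCompact_range hθ).isClosed
      filter_upwards [hc.isOpen_compl.mem_nhds (x := x) (by simpa using hx)] with y hy z hz
      exact absurd ⟨z, hz⟩ hy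

open Manifold in
theorem exists_contDiff_separating {G : Type*} [NormedAddCommGroup G] [NormedSpace ℝ G]
    [FiniteDimensional ℝ G] {s t : Set G} (hs : IsClosed s) (ht : IsClosed t)
    (hd : Disjoint s t) : ∃ W : G → ℝ, ContDiff ℝ 1 W ∧ (∀ z ∈ s, W z = 0) ∧ ∀ z ∈ t, W z = 1 := by
  obtain ⟨W, h0, h1, -⟩ := exists_contMDiffMap_zero_one_of_isClosed (n := 1) 𝓘(ℝ, G) hs ht hd
  exact ⟨W, W.contMDiff.contDiff, fun z hz => h0 hz, fun z hz => h1 hz⟩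

/-- Values of a map and an (odd) two-variable function on a tuple of points. -/
def pairVals {X E : Type*} {p : ℕ} (f : X → E) (F : X × X → E) (x : Fin p → X) :
    (Fin p → E) × (Fin p → Fin p → E) := (fun l => f (x l), fun l k => F (x l, x k))

/-- A closed condition on values at `p` points with `q` parameters that is generically
avoidable on `d`-dimensional compacta. -/
def Removable (E : Type) [NormedAddCommGroup E] [NormedSpace ℝ E] (d p q : ℕ)
    (R : Set (((Fin p → E) × (Fin p → Fin p → E)) × (Fin q → ℝ))) : Prop :=
  IsClosed R ∧ ∃ (V : Type) (_ : NormedAddCommGroup V) (_ : NormedSpace ℝ V)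
    (_ : FiniteDimensional ℝ V) (L₁ : V →ₗ[ℝ] Fin p → E) (L₂ : V →ₗ[ℝ] Fin p → Fin p → E)
    (Θ : ((Fin p → E) × (Fin p → Fin p → E)) × (Fin q → ℝ) → V),
    ContDiff ℝ 1 Θ ∧ (∀ ζ l k, L₂ ζ l k = - L₂ ζ k l) ∧
    (∀ v τ ζ, (v + (L₁ ζ, L₂ ζ), τ) ∈ R → ζ = Θ (v, τ)) ∧ p * d + q < Module.finrank ℝ V

/-- The odd perturbation of `F₀` with weight `w` and (arbitrary) direction `P`. -/
def oddPert {X E : Type*} [NormedAddCommGroup E] [NormedSpace ℝ E] (F₀ : X × X → E)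
    (w : X × X → ℝ) (P : X × X → E) (z : X × X) : E := F₀ z + w z • (P z - P z.swap)

theorem eq_zero_of_eq_neg {E : Type*} [AddCommGroup E] [Module ℝ E] {v : E} (h : v = -v) :
    v = 0 := by
  have h2 : (2 : ℝ) • v = 0 := by
    rw [two_smul]
    nth_rewrite 2 [h]
    exact add_neg_cancel v
  simpa using h2

section GP
variable {X : Type} [TopologicalSpace X] [CompactSpace X] [T2Space X] {E : Type}
  [NormedAddCommGroup E] [NormedSpace ℝ E] [FiniteDimensional ℝ E] {n : ℕ}

theorem exists_smooth_pair (hX : DimProp X n) (f : C(X, E)) (F : C(X × X, E))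
    (hF : ∀ x y, F (y, x) = - F (x, y)) {δ : ℝ} (hδ : 0 < δ) {U : Set (X × X)} (hU : IsOpen U)
    (hUd : ∀ x, (x, x) ∈ U) :
    ∃ (N : ℕ) (φ : C(X, Fin N → ℝ)) (ι : Type) (_ : Finite ι)
      (A : ι → (Fin n → ℝ) → (Fin N → ℝ)) (ψ : (Fin N → ℝ) → E)
      (Ψ : (Fin N → ℝ) × (Fin N → ℝ) → E), (∀ i, ContDiff ℝ 1 (A i)) ∧
      (∀ y, ∃ i, φ y ∈ Set.range (A i)) ∧ (∀ y y', φ y = φ y' → (y, y') ∈ U) ∧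
      ContDiff ℝ 1 ψ ∧ ContDiff ℝ 1 Ψ ∧ (∀ x, ‖ψ (φ x) - f x‖ < δ) ∧
      (∀ x y, ‖Ψ (φ x, φ y) - F (x, y)‖ < δ) ∧ ∀ a b, Ψ (b, a) = - Ψ (a, b) := by
  have hU1 : IsOpen {z : X × X | ‖f z.1 - f z.2‖ < δ} := isOpen_lt (by fun_prop) (by fun_prop)
  have hU2 : IsOpen {z : X × X | ∀ t, ‖F (z.1, t) - F (z.2, t)‖ < δ / 2} :=
    isOpen_forall_of_compactSpace (U := {a : (X × X) × X | ‖F (a.1.1, a.2) - F (a.1.2, a.2)‖ < δ / 2})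
      (isOpen_lt (by fun_prop) (by fun_prop))
  obtain ⟨N, φ, ι, hι, A, hA, hφ, hφU⟩ := hX _ ((hU.inter hU1).inter hU2)
    (fun y => ⟨⟨hUd y, by simpa using hδ⟩, by intro t; simpa using hδ⟩)
  obtain ⟨ψ, hψ, hψf⟩ := exists_contDiff_approx φ.continuous f.continuous (δ := δ)
    (fun z z' h => (hφU z z' h).1.2)
  obtain ⟨Ψ, hΨ, hΨF⟩ := exists_contDiff_approx (θ := fun z : X × X => (φ z.1, φ z.2))
    (by fun_prop) F.continuous (δ := δ) (by
      rintro ⟨a, b⟩ ⟨a', b'⟩ h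
      simp only [Prod.mk.injEq] at h
      have h1 := (hφU a a' h.1).2 b
      have h2 := (hφU b b' h.2).2 a'
      simp only at h1 h2
      rw [hF a' b, hF a' b', neg_sub_neg, norm_sub_rev] at h2
      calc ‖F (a, b) - F (a', b')‖ = ‖(F (a, b) - F (a', b)) + (F (a', b) - F (a', b'))‖ := by
            congr 1; abel
        _ ≤ _ := norm_add_le _ _
        _ < δ := by linarith)
  refine ⟨N, φ, ι, hι, A, ψ, fun z => (1 / 2 : ℝ) • (Ψ z - Ψ z.swap), hA, hφ,
    fun y y' h => (hφU y y' h).1.1, hψ, ?_, hψf, ?_, ?_⟩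
  · exact contDiff_const.smul (hΨ.sub (hΨ.comp (contDiff_snd.prodMk contDiff_fst)))
  · intro x y
    have h1 := hΨF (x, y)
    have h2 := hΨF (y, x)
    simp only at h1 h2
    rw [hF x y] at h2
    have : (1 / 2 : ℝ) • (Ψ (φ x, φ y) - Ψ (φ y, φ x)) - F (x, y)
        = (1 / 2 : ℝ) • ((Ψ (φ x, φ y) - F (x, y)) - (Ψ (φ y, φ x) - -F (x, y))) := by
      module
    simp only [Prod.swap_prod_mk]
    rw [this, norm_smul]
    have h3 := norm_sub_le (Ψ (φ x, φ y) - F (x, y)) (Ψ (φ y, φ x) - -F (x, y))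
    rw [Real.norm_of_nonneg (by norm_num)]
    linarith
  · intro a b
    simp only [Prod.swap_prod_mk]
    module

theorem oddPert_odd {F₀ : X × X → E} {w : X × X → ℝ} (hF₀ : ∀ x y, F₀ (y, x) = - F₀ (x, y))
    (hw : ∀ x y, w (y, x) = w (x, y)) (P : X × X → E) (x y : X) :
    oddPert F₀ w P (y, x) = - oddPert F₀ w P (x, y) := by
  simp only [oddPert, Prod.swap_prod_mk, hF₀ x y, hw x y]
  module

theorem continuous_oddPert {A : Type*} [TopologicalSpace A] {F₀ : C(X × X, E)} {w : C(X × X, ℝ)}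
    {P : A → C(X × X, E)} {z : A → X × X} (hP : Continuous P) (hz : Continuous z) :
    Continuous fun a => oddPert F₀ w (P a) (z a) := by
  unfold oddPert
  have : Continuous fun a => (z a).swap := continuous_swap.comp hz
  fun_prop

theorem dense_avoid_box (hX : DimProp X n) {F₀ : C(X × X, E)}
    (hF₀ : ∀ x y, F₀ (y, x) = - F₀ (x, y)) {w : C(X × X, ℝ)} (hw : ∀ x y, w (y, x) = w (x, y))
    (hw0 : ∀ x y, x ≠ y → 0 < w (x, y)) {p q : ℕ}
    {R : Set (((Fin p → E) × (Fin p → Fin p → E)) × (Fin q → ℝ))} (hR : Removable E n p q R)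
    {B : Fin p → Set X} (hB : ∀ l, IsClosed (B l)) (hBd : ∀ l k, l ≠ k → Disjoint (B l) (B k)) :
    Dense {s : C(X, E) × C(X × X, E) | ∀ x : Fin p → X, (∀ l, x l ∈ B l) →
      ∀ τ, (pairVals s.1 (oddPert F₀ w s.2) x, τ) ∉ R} := by
  obtain ⟨-, V, _, _, _, L₁, L₂, Θ, hΘ, hL₂, hRΘ, hdim⟩ := hR
  rw [Metric.dense_iff]
  rintro ⟨f, P⟩ ε hε
  have hK : IsCompact (⋃ l, ⋃ k, ⋃ (_ : l ≠ k), B l ×ˢ B k) :=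
    isCompact_iUnion fun l => isCompact_iUnion fun k => isCompact_iUnion fun _ =>
      (hB l).isCompact.prod (hB k).isCompact
  obtain ⟨c, hc, hcw⟩ := hK.exists_forall_le' w.continuous.continuousOn (a := 0) (by
    rintro ⟨x, y⟩ h
    simp only [Set.mem_iUnion, Set.mem_prod] at h
    obtain ⟨l, k, hlk, hx, hy⟩ := h
    exact hw0 x y fun e => Set.disjoint_left.1 (hBd l k hlk) hx (e ▸ hy))
  let F : C(X × X, E) := ⟨oddPert F₀ w P, continuous_oddPert continuous_const continuous_id⟩
  have hF : ∀ x y, F (y, x) = - F (x, y) := oddPert_odd hF₀ hw P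
  obtain ⟨δ, hδ, hδ1, hδ2⟩ : ∃ δ > 0, 4 * δ ≤ ε ∧ 4 * δ ≤ c * ε :=
    ⟨min (ε / 4) (c * ε / 4), by positivity, by linarith [min_le_left (ε / 4) (c * ε / 4)],
      by linarith [min_le_right (ε / 4) (c * ε / 4)]⟩
  obtain ⟨N, φ, ι, _, A, ψ, Ψ, hA, hφ, hφU, hψ, hΨ, hψf, hΨF, hΨo⟩ :=
    exists_smooth_pair hX f F hF hδ (U := (⋃ l, ⋃ k, ⋃ (_ : l ≠ k), B l ×ˢ B k)ᶜ)
      hK.isClosed.isOpen_compl (by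
        intro x h
        simp only [Set.mem_iUnion, Set.mem_prod] at h
        obtain ⟨l, k, hlk, hx, hy⟩ := h
        exact Set.disjoint_left.1 (hBd l k hlk) hx hy)
  have hW : ∀ l, ∃ W : (Fin N → ℝ) → ℝ, ContDiff ℝ 1 W ∧
      (∀ z ∈ ⋃ k, ⋃ (_ : l ≠ k), φ '' B k, W z = 0) ∧ ∀ z ∈ φ '' B l, W z = 1 := by
    intro l
    refine exists_contDiff_separating ?_ ((hB l).isCompact.image φ.continuous).isClosed ?_
    · exact (isCompact_iUnion fun k => isCompact_iUnion fun _ =>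
        (hB k).isCompact.image φ.continuous).isClosed
    · rw [Set.disjoint_left]
      rintro z hz ⟨y, hy, rfl⟩
      simp only [Set.mem_iUnion] at hz
      obtain ⟨k, hlk, y', hy', he⟩ := hz
      apply hφU y y' he.symm
      simp only [Set.mem_iUnion]
      exact ⟨l, k, hlk, hy, hy'⟩
  choose W hWs hW0 hW1 using hW
  have hWv : ∀ l k (y : X), y ∈ B k → W l (φ y) = if k = l then 1 else 0 := by
    intro l k y hy
    split_ifs with h
    · exact hW1 l _ ⟨y, h ▸ hy, rfl⟩
    · refine hW0 l _ ?_
      simp only [Set.mem_iUnion]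
      exact ⟨k, fun e => h e.symm, y, hy, rfl⟩
  have hWc : ∀ l, Continuous fun y => W l (φ y) := fun l => (hWs l).continuous.comp φ.continuous
  have hL₁c : Continuous L₁ := L₁.continuous_of_finiteDimensional
  have hL₂c : Continuous L₂ := L₂.continuous_of_finiteDimensional
  let g : (Fin p → Fin N → ℝ) × (Fin q → ℝ) → V := fun v =>
    Θ ((fun l => ψ (v.1 l), fun l k => Ψ (v.1 l, v.1 k)), v.2)
  have hg : ContDiff ℝ 1 g := by
    refine hΘ.comp ((ContDiff.prodMk ?_ ?_).prodMk contDiff_snd)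
    · exact contDiff_pi.2 fun l => hψ.comp ((contDiff_apply ℝ (Fin N → ℝ) l).comp contDiff_fst)
    · refine contDiff_pi.2 fun l => contDiff_pi.2 fun k => hΨ.comp (ContDiff.prodMk ?_ ?_)
      · exact (contDiff_apply ℝ (Fin N → ℝ) l).comp contDiff_fst
      · exact (contDiff_apply ℝ (Fin N → ℝ) k).comp contDiff_fst
  have hdense := dense_avoid hA hφ hg hdim
  let p₁ : V × X → E := fun a => ∑ l, W l (φ a.2) • L₁ a.1 l
  let p₂ : V × (X × X) → E := fun a => ∑ l, ∑ k, (W l (φ a.2.1) * W k (φ a.2.2)) • L₂ a.1 l k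
  have hp₁ : Continuous p₁ := by
    refine continuous_finsetSum _ fun l _ => ?_
    exact ((hWc l).comp continuous_snd).smul
      ((continuous_apply l).comp (hL₁c.comp continuous_fst))
  have hp₂ : Continuous p₂ := by
    refine continuous_finsetSum _ fun l _ => continuous_finsetSum _ fun k _ => ?_
    refine (((hWc l).comp (continuous_fst.comp continuous_snd)).mul
      ((hWc k).comp (continuous_snd.comp continuous_snd))).smul ?_
    exact (continuous_apply k).comp ((continuous_apply l).comp (hL₂c.comp continuous_fst))
  have hO₁ := isOpen_forall_of_compactSpace (isOpen_lt hp₁.norm (continuous_const (y := δ)))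
  have hO₂ := isOpen_forall_of_compactSpace (isOpen_lt hp₂.norm (continuous_const (y := δ)))
  obtain ⟨ζ, ⟨hζ1, hζ2⟩, hζ⟩ := hdense.inter_open_nonempty _ (hO₁.inter hO₂)
    ⟨0, by simp [p₁, hδ], by simp [p₂, hδ]⟩
  simp only [Set.mem_ofPred_eq] at hζ1 hζ2 hζ
  have hp₂o : ∀ x y, p₂ (ζ, (y, x)) = - p₂ (ζ, (x, y)) := by
    intro x y
    simp only [p₂]
    rw [Finset.sum_comm, ← Finset.sum_neg_distrib]
    refine Finset.sum_congr rfl fun l _ => ?_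
    rw [← Finset.sum_neg_distrib]
    refine Finset.sum_congr rfl fun k _ => ?_
    rw [hL₂ ζ l k, smul_neg, neg_neg, mul_comm]
  let f' : C(X, E) := ⟨fun x => ψ (φ x) + p₁ (ζ, x), by
    have := hψ.continuous; fun_prop⟩
  let F' : C(X × X, E) := ⟨fun z => Ψ (φ z.1, φ z.2) + p₂ (ζ, z), by
    have := hΨ.continuous; fun_prop⟩
  have hF' : ∀ x y, F' (y, x) = - F' (x, y) := by
    intro x y
    simp only [F', ContinuousMap.coe_mk, hΨo (φ x) (φ y), hp₂o x y]
    abel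
  have hmax : ∀ z, 0 < max (w z) c := fun z => lt_max_of_lt_right hc
  let P' : C(X × X, E) := ⟨fun z => P z + (1 / (2 * max (w z) c)) • (F' z - F z), by
    refine P.continuous.add (Continuous.smul ?_ (by fun_prop))
    exact continuous_const.div (by fun_prop) fun z => by have := hmax z; positivity⟩
  have hf'f : ∀ x, ‖f' x - f x‖ < 2 * δ := by
    intro x
    have h1 := hψf x
    have h2 := hζ1 x
    calc ‖f' x - f x‖ = ‖(ψ (φ x) - f x) + p₁ (ζ, x)‖ := by
          congr 1; simp only [f', ContinuousMap.coe_mk]; abel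
      _ ≤ _ := norm_add_le _ _
      _ < 2 * δ := by linarith
  have hF'F : ∀ z, ‖F' z - F z‖ < 2 * δ := by
    intro z
    have h1 := hΨF z.1 z.2
    have h2 := hζ2 z
    calc ‖F' z - F z‖ = ‖(Ψ (φ z.1, φ z.2) - F z) + p₂ (ζ, z)‖ := by
          congr 1; simp only [F', ContinuousMap.coe_mk]; abel
      _ ≤ _ := norm_add_le _ _
      _ < 2 * δ := by linarith
  have hP' : ∀ x : Fin p → X, (∀ l, x l ∈ B l) → ∀ l k,
      oddPert F₀ w P' (x l, x k) = F' (x l, x k) := by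
    intro x hx l k
    by_cases hlk : l = k
    · subst hlk
      rw [eq_zero_of_eq_neg (oddPert_odd hF₀ hw P' (x l) (x l)), eq_zero_of_eq_neg (hF' (x l) (x l))]
    · have h2 : max (w (x l, x k)) c = w (x l, x k) := max_eq_left <| hcw _ <| by
        simp only [Set.mem_iUnion, Set.mem_prod]
        exact ⟨l, k, hlk, hx l, hx k⟩
      have h3 : w (x l, x k) ≠ 0 := h2 ▸ (hmax (x l, x k)).ne'
      have h1 : w (x l, x k) * (1 / (2 * w (x l, x k))) = 1 / 2 := by field_simp
      have h4 : F (x l, x k) = F₀ (x l, x k) + w (x l, x k) • (P (x l, x k) - P (x k, x l)) := rfl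
      have h5 : oddPert F₀ w P' (x l, x k) = F (x l, x k) +
          (2 * (w (x l, x k) * (1 / (2 * w (x l, x k))))) • (F' (x l, x k) - F (x l, x k)) := by
        rw [h4]
        simp only [oddPert, P', ContinuousMap.coe_mk, Prod.swap_prod_mk, hF' (x l) (x k),
          hF (x l) (x k), hw (x l) (x k), h2]
        rw [h4]
        module
      rw [h5, h1]
      module
  refine ⟨(f', P'), ?_, ?_⟩
  · rw [mem_ball, Prod.dist_eq, max_lt_iff, ContinuousMap.dist_lt_iff hε,
      ContinuousMap.dist_lt_iff hε]
    refine ⟨fun x => ?_, fun z => ?_⟩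
    · rw [dist_eq_norm]
      linarith [hf'f x]
    · rw [dist_eq_norm]
      simp only [P', ContinuousMap.coe_mk, add_sub_cancel_left]
      rw [norm_smul, Real.norm_of_nonneg (by have := hmax z; positivity), one_div,
        inv_mul_lt_iff₀ (by have := hmax z; positivity)]
      have h1 := hF'F z
      have h2 : c * ε ≤ max (w z) c * ε := by gcongr; exact le_max_right _ _
      linarith
  · intro x hx τ hmem
    apply hζ x τ
    apply hRΘ
    convert hmem using 2
    refine Prod.ext (funext fun l => ?_) (funext fun l => funext fun k => ?_)
    · simp [pairVals, f', p₁, hWv _ _ _ (hx _)]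
    · simp only [pairVals, hP' x hx]
      simp [F', p₂, hWv _ _ _ (hx _)]
end GP

section GPB
variable {X : Type} [MetricSpace X] [CompactSpace X] {E : Type}
  [NormedAddCommGroup E] [NormedSpace ℝ E] [FiniteDimensional ℝ E] {n : ℕ}

theorem isOpen_avoid_box (F₀ : C(X × X, E)) (w : C(X × X, ℝ)) {p q : ℕ}
    {R : Set (((Fin p → E) × (Fin p → Fin p → E)) × (Fin q → ℝ))} (hR : IsClosed R)
    {B : Fin p → Set X} (hB : ∀ l, IsClosed (B l)) (M : ℝ) :
    IsOpen {s : C(X, E) × C(X × X, E) | ∀ x : Fin p → X, (∀ l, x l ∈ B l) →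
      ∀ τ ∈ closedBall (0 : Fin q → ℝ) M, (pairVals s.1 (oddPert F₀ w s.2) x, τ) ∉ R} := by
  have hK : IsCompact ((Set.univ.pi B) ×ˢ closedBall (0 : Fin q → ℝ) M) :=
    (isCompact_univ_pi fun l => (hB l).isCompact).prod (isCompact_closedBall _ _)
  have := isOpen_forall_mem_of_isCompact hK
    (U := {a : (C(X, E) × C(X × X, E)) × ((Fin p → X) × (Fin q → ℝ)) |
      (pairVals a.1.1 (oddPert F₀ w a.1.2) a.2.1, a.2.2) ∉ R}) ?_
  · convert this using 1
    ext s
    simp only [Set.mem_ofPred_eq, Set.mem_prod, Set.mem_univ_pi, Prod.forall, and_imp]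
    exact ⟨fun h x τ hx hτ => h x hx τ hτ, fun h x hx τ hτ => h x τ hx hτ⟩
  · refine hR.isOpen_compl.preimage ?_
    unfold pairVals
    refine ((?_ : Continuous _).prodMk ?_).prodMk (by fun_prop)
    · fun_prop
    · refine continuous_pi fun l => continuous_pi fun k => ?_
      exact continuous_oddPert (by fun_prop) (by fun_prop)

theorem exists_general_position (hX : DimProp X n) {F₀ : C(X × X, E)}
    (hF₀ : ∀ x y, F₀ (y, x) = - F₀ (x, y)) (hF₀0 : ∀ x y, F₀ (x, y) = 0 → x = y) (f₀ : C(X, E))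
    {ε : ℝ} (hε : 0 < ε) {ι : Type} [Countable ι] (p q : ι → ℕ)
    (R : ∀ i, Set (((Fin (p i) → E) × (Fin (p i) → Fin (p i) → E)) × (Fin (q i) → ℝ)))
    (hR : ∀ i, Removable E n (p i) (q i) (R i)) :
    ∃ (f : C(X, E)) (F : C(X × X, E)), (∀ x y, F (y, x) = - F (x, y)) ∧
      (∀ x, ‖f x - f₀ x‖ ≤ ε) ∧ (∀ z, ‖F z - F₀ z‖ ≤ ε * ‖F₀ z‖) ∧
      ∀ i, ∀ x : Fin (p i) → X, Function.Injective x → ∀ τ, (pairVals f F x, τ) ∉ R i := by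
  let w : C(X × X, ℝ) := ⟨fun z => ‖F₀ z‖, by fun_prop⟩
  have hw : ∀ x y, w (y, x) = w (x, y) := fun x y => by simp [w, hF₀ x y]
  have hw0 : ∀ x y, x ≠ y → 0 < w (x, y) := fun x y h =>
    norm_pos_iff.2 fun h0 => h (hF₀0 x y h0)
  obtain ⟨D, hDc, hDd⟩ := TopologicalSpace.exists_countable_dense X
  have : Countable D := hDc.to_subtype
  let box : ∀ i, (Fin (p i) → D) → ℕ → Fin (p i) → Set X :=
    fun i c N l => closedBall (c l : X) (1 / (N + 1))
  let J := {j : Σ i, (Fin (p i) → D) × ℕ × ℕ //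
    ∀ l k, l ≠ k → Disjoint (box j.1 j.2.1 j.2.2.1 l) (box j.1 j.2.1 j.2.2.1 k)}
  let S : J → Set (C(X, E) × C(X × X, E)) := fun j =>
    {s | ∀ x : Fin (p j.1.1) → X, (∀ l, x l ∈ box j.1.1 j.1.2.1 j.1.2.2.1 l) →
      ∀ τ ∈ closedBall (0 : Fin (q j.1.1) → ℝ) j.1.2.2.2,
        (pairVals s.1 (oddPert F₀ w s.2) x, τ) ∉ R j.1.1}
  have hSo : ∀ j, IsOpen (S j) := fun j =>
    isOpen_avoid_box F₀ w (hR _).1 (fun l => isClosed_closedBall) _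
  have hSd : ∀ j, Dense (S j) := fun j =>
    (dense_avoid_box hX hF₀ hw hw0 (hR _) (fun l => isClosed_closedBall) j.2).mono
      (by intro s hs x hx τ _; exact hs x hx τ)
  have hd := dense_iInter_of_isOpen hSo hSd
  obtain ⟨⟨f, P⟩, hs, hball⟩ := hd.exists_mem_open (isOpen_ball (x := (f₀, (0 : C(X × X, E))))
    (ε := ε / 2)) ⟨(f₀, 0), mem_ball_self (by positivity)⟩
  rw [mem_ball, Prod.dist_eq, max_lt_iff, ContinuousMap.dist_lt_iff (by positivity),
      ContinuousMap.dist_lt_iff (by positivity)] at hball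
  obtain ⟨hb1, hb2⟩ := hball
  refine ⟨f, ⟨oddPert F₀ w P, continuous_oddPert continuous_const continuous_id⟩,
    oddPert_odd hF₀ hw P, fun x => ?_, fun z => ?_, fun i x hx τ => ?_⟩
  · have := hb1 x
    rw [dist_eq_norm] at this
    linarith
  · have h1 := hb2 z
    have h2 := hb2 z.swap
    simp only [dist_eq_norm, ContinuousMap.zero_apply, sub_zero] at h1 h2
    simp only [ContinuousMap.coe_mk, oddPert, add_sub_cancel_left]
    rw [norm_smul]
    simp only [w, ContinuousMap.coe_mk, norm_norm]
    rw [mul_comm]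
    gcongr
    linarith [norm_sub_le (P z) (P z.swap)]
  · obtain ⟨r, hr, hxr⟩ : ∃ r > 0, ∀ l k, l ≠ k → r ≤ dist (x l) (x k) := by
      have hfin : (Set.range fun a : {a : Fin (p i) × Fin (p i) // a.1 ≠ a.2} =>
        dist (x a.1.1) (x a.1.2)).Finite := Set.finite_range _
      obtain ⟨r, hr, h⟩ := hfin.isCompact.exists_forall_le' (f := id) continuousOn_id (a := 0)
        (by rintro _ ⟨a, rfl⟩; exact dist_pos.2 fun h => a.2 (hx h))
      exact ⟨r, hr, fun l k h' => h _ ⟨⟨(l, k), h'⟩, rfl⟩⟩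
    obtain ⟨N, hN⟩ := exists_nat_one_div_lt (show 0 < r / 4 by positivity)
    have hc : ∀ l, ∃ d : D, dist (x l) d < 1 / (N + 1) := fun l => by
      obtain ⟨d, hd, h⟩ := hDd.exists_dist_lt (x l) (ε := 1 / (N + 1)) (by positivity)
      exact ⟨⟨d, hd⟩, h⟩
    choose c hc using hc
    obtain ⟨M, hM⟩ := exists_nat_ge ‖τ‖
    have hdis : ∀ l k, l ≠ k → Disjoint (box i c N l) (box i c N k) := by
      intro l k hlk
      rw [Set.disjoint_left]
      intro z hz hz'
      simp only [box, mem_closedBall] at hz hz'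
      have h1 := dist_triangle4 (x l) (c l) (c k) (x k)
      have h2 := dist_triangle_left (c l : X) (c k) z
      have h3 := hc l
      have h4 := hc k
      rw [dist_comm] at h4
      linarith [hxr l k hlk]
    exact Set.mem_iInter.1 hs ⟨⟨i, c, N, M⟩, hdis⟩ x (fun l => (hc l).le) τ (by simpa using hM)
end GPB

section Conditions
variable (E : Type) [NormedAddCommGroup E] [NormedSpace ℝ E]

/-- One point is the common start of two rays. -/
def twoRaysSet : Set (((Fin 3 → E) × (Fin 3 → Fin 3 → E)) × (Fin 2 → ℝ)) :=
  {v | v.1.2 0 1 = v.2 0 • (v.1.1 1 - v.1.1 0) ∧ v.1.2 0 2 = v.2 1 • (v.1.1 2 - v.1.1 0)}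

/-- A third point lies on the line of a ray. -/
def thirdPointSet : Set (((Fin 3 → E) × (Fin 3 → Fin 3 → E)) × (Fin 2 → ℝ)) :=
  {v | v.1.2 0 1 = v.2 0 • (v.1.1 1 - v.1.1 0) ∧ v.1.1 2 = v.1.1 0 + v.2 1 • (v.1.1 1 - v.1.1 0)}

/-- Two disjoint rays have intersecting lines. -/
def crossingRaysSet : Set (((Fin 4 → E) × (Fin 4 → Fin 4 → E)) × (Fin 4 → ℝ)) :=
  {v | v.1.2 0 1 = v.2 0 • (v.1.1 1 - v.1.1 0) ∧ v.1.2 2 3 = v.2 1 • (v.1.1 3 - v.1.1 2) ∧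
    v.1.1 0 + v.2 2 • v.1.1 1 = (1 + v.2 2) • (v.1.1 2 + v.2 3 • (v.1.1 3 - v.1.1 2))}

variable {E} [FiniteDimensional ℝ E] {n : ℕ}

/-- The antisymmetric array with first row `(0, ζ.1, ζ.2)`. -/
def rayArray (E : Type) [NormedAddCommGroup E] [NormedSpace ℝ E] :
    E × E →ₗ[ℝ] Fin 3 → Fin 3 → E where
  toFun ζ := ![![0, ζ.1, ζ.2], ![-ζ.1, 0, 0], ![-ζ.2, 0, 0]]
  map_add' a b := by ext l k; fin_cases l <;> fin_cases k <;> simp [add_comm]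
  map_smul' a b := by ext l k; fin_cases l <;> fin_cases k <;> simp

/-- The triple of vectors starting with `0`. -/
def pointArray (E : Type) [NormedAddCommGroup E] [NormedSpace ℝ E] :
    E × E →ₗ[ℝ] Fin 3 → E where
  toFun ζ := ![0, ζ.1, ζ.2]
  map_add' a b := by ext l; fin_cases l <;> simp
  map_smul' a b := by ext l; fin_cases l <;> simp

theorem rayArray_antisymm (ζ : E × E) (l k : Fin 3) : rayArray E ζ l k = - rayArray E ζ k l := by
  fin_cases l <;> fin_cases k <;> simp [rayArray]

theorem removable_twoRaysSet (h : 3 * n + 2 < 2 * Module.finrank ℝ E) :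
    Removable E n 3 2 (twoRaysSet E) := by
  refine ⟨(isClosed_eq (by fun_prop) (by fun_prop)).inter
    (isClosed_eq (by fun_prop) (by fun_prop)), E × E, inferInstance, inferInstance,
    inferInstance, 0, rayArray E,
    fun v => (v.2 0 • (v.1.1 1 - v.1.1 0) - v.1.2 0 1, v.2 1 • (v.1.1 2 - v.1.1 0) - v.1.2 0 2),
    by fun_prop, rayArray_antisymm, ?_, ?_⟩
  · rintro v τ ζ ⟨h1, h2⟩
    simp [rayArray] at h1 h2
    exact Prod.ext (by simp [← h1]) (by simp [← h2])
  · rw [Module.finrank_prod]; omega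

theorem removable_thirdPointSet (h : 3 * n + 2 < 2 * Module.finrank ℝ E) :
    Removable E n 3 2 (thirdPointSet E) := by
  refine ⟨(isClosed_eq (by fun_prop) (by fun_prop)).inter
    (isClosed_eq (by fun_prop) (by fun_prop)), E × E, inferInstance, inferInstance,
    inferInstance, { toFun := fun ζ => ![0, 0, ζ.2], map_add' := ?_, map_smul' := ?_ },
    { toFun := fun ζ => ![![0, ζ.1, 0], ![-ζ.1, 0, 0], ![0, 0, 0]],
      map_add' := ?_, map_smul' := ?_ },
    fun v => (v.2 0 • (v.1.1 1 - v.1.1 0) - v.1.2 0 1,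
      v.1.1 0 + v.2 1 • (v.1.1 1 - v.1.1 0) - v.1.1 2),
    ?_, ?_, ?_, ?_⟩
  · intro a b
    ext l
    fin_cases l <;> simp
  · intro a b
    ext l
    fin_cases l <;> simp
  · intro a b
    ext l k
    fin_cases l <;> fin_cases k <;> simp [add_comm]
  · intro a b
    ext l k
    fin_cases l <;> fin_cases k <;> simp
  · fun_prop
  · intro ζ l k
    fin_cases l <;> fin_cases k <;> simp
  · rintro v τ ζ ⟨h1, h2⟩
    simp at h1 h2
    exact Prod.ext (by simp [← h1]) (by simp [← h2])
  · rw [Module.finrank_prod]; omega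

theorem removable_crossingRaysSet (h : 4 * n + 4 < 3 * Module.finrank ℝ E) :
    Removable E n 4 4 (crossingRaysSet E) := by
  refine ⟨(isClosed_eq (by fun_prop) (by fun_prop)).inter
    ((isClosed_eq (by fun_prop) (by fun_prop)).inter (isClosed_eq (by fun_prop) (by fun_prop))),
    E × E × E, inferInstance, inferInstance,
    inferInstance, { toFun := fun ζ => ![ζ.2.2, 0, 0, 0], map_add' := ?_, map_smul' := ?_ },
    { toFun := fun ζ => ![![0, ζ.1, 0, 0], ![-ζ.1, 0, 0, 0], ![0, 0, 0, ζ.2.1], ![0, 0, -ζ.2.1, 0]],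
      map_add' := ?_, map_smul' := ?_ },
    fun v => (v.2 0 • (v.1.1 1 - ((1 + v.2 2) • (v.1.1 2 + v.2 3 • (v.1.1 3 - v.1.1 2)) -
        v.2 2 • v.1.1 1)) - v.1.2 0 1,
      v.2 1 • (v.1.1 3 - v.1.1 2) - v.1.2 2 3,
      (1 + v.2 2) • (v.1.1 2 + v.2 3 • (v.1.1 3 - v.1.1 2)) - v.2 2 • v.1.1 1 - v.1.1 0),
    ?_, ?_, ?_, ?_⟩
  · intro a b
    ext l
    fin_cases l <;> simp
  · intro a b
    ext l
    fin_cases l <;> simp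
  · intro a b
    ext l k
    fin_cases l <;> fin_cases k <;> simp [add_comm]
  · intro a b
    ext l k
    fin_cases l <;> fin_cases k <;> simp
  · fun_prop
  · intro ζ l k
    fin_cases l <;> fin_cases k <;> simp
  · rintro v τ ζ ⟨h1, h2, h3⟩
    simp at h1 h2 h3
    rw [← smul_add] at h3
    refine Prod.ext ?_ (Prod.ext ?_ ?_)
    · simp only [← h3, add_sub_cancel_right, ← h1]; abel
    · simp [← h2]
    · simp only [← h3]; abel
  · rw [Module.finrank_prod, Module.finrank_prod]; omega

/-- Two rays from a common point, seen in all coordinates except the `k`-th. -/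
def coordSet {m : ℕ} (k : Fin m) :
    Set (((Fin 3 → EuclideanSpace ℝ (Fin m)) × (Fin 3 → Fin 3 → EuclideanSpace ℝ (Fin m))) ×
      (Fin 0 → ℝ)) :=
  {v | (∀ j < k, v.1.1 0 j = v.1.1 1 j ∧ v.1.1 0 j = v.1.1 2 j) ∧
    ∀ j > k, v.1.2 0 1 j = 0 ∧ v.1.2 0 2 j = 0}

theorem removable_coordSet {m : ℕ} (k : Fin m) (h : 3 * n < 2 * (m - 1)) :
    Removable (EuclideanSpace ℝ (Fin m)) n 3 0 (coordSet k) := by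
  let lo : ({j // j ≠ k} → ℝ) →ₗ[ℝ] EuclideanSpace ℝ (Fin m) :=
    { toFun := fun ζ => WithLp.toLp 2 fun j => if h : j < k then ζ ⟨j, h.ne⟩ else 0
      map_add' := fun a b => by ext j; simp; split_ifs <;> simp
      map_smul' := fun a b => by ext j; simp }
  let hi : ({j // j ≠ k} → ℝ) →ₗ[ℝ] EuclideanSpace ℝ (Fin m) :=
    { toFun := fun ζ => WithLp.toLp 2 fun j => if h : k < j then ζ ⟨j, h.ne'⟩ else 0
      map_add' := fun a b => by ext j; simp; split_ifs <;> simp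
      map_smul' := fun a b => by ext j; simp }
  refine ⟨?_, ({j // j ≠ k} → ℝ) × ({j // j ≠ k} → ℝ), inferInstance, inferInstance,
    inferInstance, (pointArray _).comp (lo.prodMap lo), (rayArray _).comp (hi.prodMap hi),
    fun v => (fun j => if j.1 < k then v.1.1 0 j - v.1.1 1 j else - v.1.2 0 1 j,
      fun j => if j.1 < k then v.1.1 0 j - v.1.1 2 j else - v.1.2 0 2 j),
    ?_, fun ζ => rayArray_antisymm _, ?_, ?_⟩
  · simp only [coordSet, Set.ofPred_and, Set.ofPred_forall]
    refine (isClosed_iInter fun j => isClosed_iInter fun _ => ?_).inter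
      (isClosed_iInter fun j => isClosed_iInter fun _ => ?_)
    · exact (isClosed_eq (by fun_prop) (by fun_prop)).inter
        (isClosed_eq (by fun_prop) (by fun_prop))
    · exact (isClosed_eq (by fun_prop) (by fun_prop)).inter
        (isClosed_eq (by fun_prop) (by fun_prop))
  · refine ContDiff.prodMk (contDiff_pi.2 fun j => ?_) (contDiff_pi.2 fun j => ?_)
    · by_cases h : j.1 < k
      · simp only [h, if_true]; fun_prop
      · simp only [h, if_false]; fun_prop
    · by_cases h : j.1 < k
      · simp only [h, if_true]; fun_prop
      · simp only [h, if_false]; fun_prop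
  · rintro v τ ζ ⟨h1, h2⟩
    have hlo : ∀ (a : {j // j ≠ k} → ℝ) (j : Fin m) (hj : j < k), lo a j = a ⟨j, hj.ne⟩ := by
      intro a j hj; simp [lo, hj]
    have hhi : ∀ (a : {j // j ≠ k} → ℝ) (j : Fin m) (hj : k < j), hi a j = a ⟨j, hj.ne'⟩ := by
      intro a j hj; simp [hi, hj]
    have e1 : pointArray _ (lo.prodMap lo ζ) = ![0, lo ζ.1, lo ζ.2] := rfl
    have e2 : rayArray _ (hi.prodMap hi ζ) 0 = ![0, hi ζ.1, hi ζ.2] := rfl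
    simp only [LinearMap.comp_apply, Prod.fst_add, Prod.snd_add, Pi.add_apply, e1, e2,
      PiLp.add_apply, Matrix.cons_val] at h1 h2
    refine Prod.ext (funext fun j => ?_) (funext fun j => ?_)
    · by_cases h : j.1 < k
      · have := (h1 j h).1
        rw [hlo _ _ h, PiLp.zero_apply] at this
        simp only [h, if_true]
        linarith
      · have h' := lt_of_le_of_ne (not_lt.1 h) j.2.symm
        have := (h2 j h').1
        rw [hhi _ _ h'] at this
        simp only [h, if_false]
        linarith
    · by_cases h : j.1 < k
      · have := (h1 j h).2
        rw [hlo _ _ h, PiLp.zero_apply] at this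
        simp only [h, if_true]
        linarith
      · have h' := lt_of_le_of_ne (not_lt.1 h) j.2.symm
        have := (h2 j h').2
        rw [hhi _ _ h'] at this
        simp only [h, if_false]
        linarith
  · rw [Module.finrank_prod, Module.finrank_pi]
    simp [Fintype.card_subtype_compl]
    omega
end Conditions

theorem dimProp_of_coveringDimLE {X : Type} [TopologicalSpace X] [CompactSpace X] [T2Space X]
    {n : ℕ} (h : CoveringDimLE X n) : DimProp X n := by
  intro U hU hUd
  obtain ⟨V, hVo, hVc, hVU, hVn⟩ := h {u | IsOpen u ∧ u ×ˢ u ⊆ U} (fun u hu => hu.1) (by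
    rw [Set.eq_univ_iff_forall]
    intro x
    obtain ⟨a, ha, b, hb, hab⟩ := mem_nhds_prod_iff.1 (hU.mem_nhds (hUd x))
    obtain ⟨u, hu, huo, hxu⟩ := mem_nhds_iff.1 (Filter.inter_mem ha hb)
    exact ⟨u, ⟨huo, (Set.prod_mono (fun z hz => (hu hz).1) fun z hz => (hu hz).2).trans hab⟩, hxu⟩)
  obtain ⟨t, ht⟩ := isCompact_univ.elim_finite_subcover (fun v : V => (v : Set X))
    (fun v => hVo v v.2) (by rw [← hVc, Set.sUnion_eq_iUnion])
  let e := t.equivFin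
  let v : Fin t.card → Set X := fun i => ((e.symm i : V) : Set X)
  have hv : ∀ i, v i ∈ V := fun i => (e.symm i : V).2
  have hvinj : Function.Injective v := fun i j hij => by
    exact e.symm.injective (Subtype.ext (Subtype.ext hij))
  obtain ⟨ρ, hρ⟩ := PartitionOfUnity.exists_isSubordinate isClosed_univ v
    (fun i => hVo _ (hv i)) (by
      intro x hx
      obtain ⟨w, hw, hxw⟩ := Set.mem_iUnion₂.1 (ht hx)
      exact Set.mem_iUnion.2 ⟨e ⟨w, hw⟩, by simpa [v] using hxw⟩)
  have hsum : ∀ x, ∑ i, ρ i x = 1 := fun x => by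
    rw [← finsum_eq_sum_of_fintype]; exact ρ.sum_eq_one (Set.mem_univ x)
  have hmem : ∀ i x, ρ i x ≠ 0 → x ∈ v i := fun i x hx => hρ i (subset_tsupport _ hx)
  let φ : C(X, Fin t.card → ℝ) := ⟨fun x i => ρ i x, by fun_prop⟩
  let A : Fin t.card × (Fin n → Fin t.card) → (Fin n → ℝ) → (Fin t.card → ℝ) := fun a b =>
    Pi.single a.1 1 + ∑ l, b l • (Pi.single (a.2 l) 1 - Pi.single a.1 1)
  refine ⟨t.card, φ, _, inferInstance, A, fun a => by fun_prop, fun x => ?_, fun x y hxy => ?_⟩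
  · obtain ⟨i₀, hi₀⟩ : ∃ i, ρ i x ≠ 0 := by
      by_contra! hcon
      simpa [hcon] using hsum x
    let S : Finset (Fin t.card) := (Finset.univ.filter fun i => ρ i x ≠ 0).erase i₀
    have hcard : S.card ≤ n := by
      have h1 := (Finset.card_erase_of_mem
        (show i₀ ∈ Finset.univ.filter fun i => ρ i x ≠ 0 by simpa using hi₀))
      have h2 : (Finset.univ.filter fun i => ρ i x ≠ 0).card ≤ n + 1 := by
        refine le_trans ?_ (hVn x).2
        rw [← Finset.card_image_of_injective _ hvinj, ← Set.ncard_coe_finset]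
        refine Set.ncard_le_ncard ?_ (hVn x).1
        intro w hw
        simp only [Finset.coe_image, Finset.coe_filter, Finset.mem_univ, true_and,
          Set.mem_image] at hw
        obtain ⟨i, hi, rfl⟩ := hw
        exact ⟨hv i, hmem i x hi⟩
      change ((Finset.univ.filter fun i => ρ i x ≠ 0).erase i₀).card ≤ n
      omega
    obtain ⟨f⟩ : Nonempty (S ↪ Fin n) := Function.Embedding.nonempty_of_card_le (by simpa)
    let c : Fin n → Fin t.card := Function.extend f Subtype.val fun _ => i₀
    refine ⟨(i₀, c), fun l => ρ (c l) x, ?_⟩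
    have h1 : ∑ l, ρ (c l) x • ((Pi.single (c l) 1 : Fin t.card → ℝ) - Pi.single i₀ 1) =
        ∑ s : S, ρ s x • ((Pi.single (s : Fin t.card) 1 : Fin t.card → ℝ) - Pi.single i₀ 1) := by
      symm
      refine Fintype.sum_of_injective f f.injective _ _ ?_ ?_
      · intro l hl
        have : c l = i₀ := Function.extend_apply' _ _ _ hl
        simp [this]
      · intro s
        have : c (f s) = s := f.injective.extend_apply _ _ s
        rw [this]
    have h2 : ∑ s : S, ρ s x • ((Pi.single (s : Fin t.card) 1 : Fin t.card → ℝ) - Pi.single i₀ 1)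
        = ∑ s, ρ s x • ((Pi.single s 1 : Fin t.card → ℝ) - Pi.single i₀ 1) := by
      refine (Finset.sum_coe_sort S fun s => ρ s x •
        ((Pi.single s 1 : Fin t.card → ℝ) - Pi.single i₀ 1)).trans ?_
      refine Finset.sum_subset (Finset.subset_univ _) fun s _ hs => ?_
      by_cases hsi : s = i₀
      · simp [hsi]
      · have : ρ s x = 0 := by
          by_contra h0
          exact hs (by simp [S, hsi, h0])
        simp [this]
    simp only [A]
    rw [h1, h2]
    simp only [smul_sub, Finset.sum_sub_distrib, ← Finset.sum_smul, hsum, one_smul,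
      add_sub_cancel]
    ext j
    simp [φ, Finset.sum_apply, Pi.single_apply]
  · obtain ⟨i, hi⟩ : ∃ i, ρ i x ≠ 0 := by
      by_contra! hcon
      simpa [hcon] using hsum x
    obtain ⟨u, hu, hvu⟩ := hVU _ (hv i)
    refine hu.2 ⟨hvu (hmem i x hi), hvu (hmem i y fun h0 => hi ((congrFun hxy i).trans h0))⟩

/-- The quotient map onto the suspension. -/
def suspMk {Y : Type} (z : Y × I) : Susp Y := Quotient.mk (suspSetoid Y) z

theorem continuous_suspMk {Y : Type} [TopologicalSpace Y] : Continuous (suspMk (Y := Y)) :=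
  continuous_quotient_mk'

theorem suspMk_surjective {Y : Type} : Function.Surjective (suspMk (Y := Y)) :=
  Quotient.mk_surjective

theorem suspMk_eq_iff {Y : Type} {a b : Y × I} : suspMk a = suspMk b ↔ suspRel Y a b :=
  Quotient.eq (r := suspSetoid Y)

/-- Lift a continuous map that collapses both ends to the suspension. -/
def suspLift {Y Z : Type} [TopologicalSpace Y] [TopologicalSpace Z] (g : C(Y × I, Z))
    (h : ∀ a b, suspRel Y a b → g a = g b) : C(Susp Y, Z) :=
  ⟨Quotient.lift g h, g.continuous.quotient_lift h⟩

theorem suspLift_mk {Y Z : Type} [TopologicalSpace Y] [TopologicalSpace Z] (g : C(Y × I, Z))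
    (h : ∀ a b, suspRel Y a b → g a = g b) (a : Y × I) : suspLift g h (suspMk a) = g a := rfl

instance {Y : Type} [TopologicalSpace Y] [CompactSpace Y] : CompactSpace (Susp Y) :=
  inferInstanceAs (CompactSpace (Quotient (suspSetoid Y)))

/-- The cone-shaped weight on the suspension coordinate. -/
noncomputable def suspWeight (s : I) : ℝ := 1 - |2 * (s : ℝ) - 1|

@[simp] theorem suspWeight_zero : suspWeight 0 = 0 := by simp [suspWeight]

@[simp] theorem suspWeight_one : suspWeight 1 = 0 := by norm_num [suspWeight]

theorem continuous_suspWeight : Continuous suspWeight := by unfold suspWeight; fun_prop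

theorem suspWeight_eq_zero {s : I} (h : suspWeight s = 0) : s = 0 ∨ s = 1 := by
  unfold suspWeight at h
  rcases abs_cases (2 * (s : ℝ) - 1) with ⟨h1, _⟩ | ⟨h1, _⟩ <;> rw [h1] at h
  · exact Or.inr (Subtype.ext (show (s : ℝ) = 1 by linarith))
  · exact Or.inl (Subtype.ext (show (s : ℝ) = 0 by linarith))

theorem dimProp_susp {Y : Type} [TopologicalSpace Y] {d : ℕ} (h : DimProp Y d) :
    DimProp (Susp Y) (d + 1) := by
  intro U hU hUd
  have hUY : IsOpen {z : Y × Y | ∀ s : I, (suspMk (z.1, s), suspMk (z.2, s)) ∈ U} := by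
    refine isOpen_forall_of_compactSpace
      (U := {a : (Y × Y) × I | (suspMk (a.1.1, a.2), suspMk (a.1.2, a.2)) ∈ U}) ?_
    have := continuous_suspMk (Y := Y)
    exact hU.preimage (by fun_prop)
  obtain ⟨N, φ, ι, _, A, hA, hφ, hφU⟩ := h _ hUY (fun y s => hUd _)
  let ψ₀ : C(Y × I, Fin (N + 1) → ℝ) :=
    ⟨fun z => Fin.cons (z.2 : ℝ) (suspWeight z.2 • φ z.1), by
      refine continuous_pi fun i => ?_
      have := continuous_suspWeight
      refine Fin.cases ?_ (fun j => ?_) i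
      · simp only [Fin.cons_zero]; fun_prop
      · simp only [Fin.cons_succ]; fun_prop⟩
  let ψ := suspLift ψ₀ (by
    rintro ⟨a, s⟩ ⟨b, t⟩ (hab | ⟨h1, h2⟩ | ⟨h1, h2⟩)
    · rw [hab]
    · simp only at h1 h2
      simp [ψ₀, h1, h2]
    · simp only at h1 h2
      simp [ψ₀, h1, h2])
  let B : ι × Bool → (Fin (d + 1) → ℝ) → (Fin (N + 1) → ℝ) := fun a b =>
    Fin.cons (b 0) ((if a.2 then 2 * b 0 else 2 * (1 - b 0)) • A a.1 (Fin.tail b))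
  refine ⟨N + 1, ψ, ι × Bool, inferInstance, B, ?_, ?_, ?_⟩
  · rintro ⟨i, c⟩
    refine contDiff_pi.2 fun j => ?_
    have h1 : ContDiff ℝ 1 fun b : Fin (d + 1) → ℝ => A i (Fin.tail b) := by
      refine (hA i).comp ?_
      unfold Fin.tail
      fun_prop
    refine Fin.cases ?_ (fun j => ?_) j
    · simp only [B, Fin.cons_zero]; fun_prop
    · simp only [B, Fin.cons_succ, Pi.smul_apply]
      have h2 := contDiff_pi.1 h1 j
      cases c
      · simp only [Bool.false_eq_true, if_false]
        exact (show ContDiff ℝ 1 fun b : Fin (d + 1) → ℝ => 2 * (1 - b 0) by fun_prop).smul h2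
      · simp only [if_true]
        exact (show ContDiff ℝ 1 fun b : Fin (d + 1) → ℝ => 2 * b 0 by fun_prop).smul h2
  · intro z
    obtain ⟨⟨y, s⟩, rfl⟩ := suspMk_surjective z
    obtain ⟨i, b, hb⟩ := hφ y
    simp only [ψ, suspLift_mk]
    rcases le_total (2 * (s : ℝ)) 1 with hs | hs
    · refine ⟨(i, true), Fin.cons (s : ℝ) b, ?_⟩
      simp [B, ψ₀, hb, suspWeight, abs_of_nonpos (sub_nonpos.2 hs)]
    · refine ⟨(i, false), Fin.cons (s : ℝ) b, ?_⟩
      simp only [B, ψ₀, Fin.cons_zero, Fin.tail_cons, hb, suspWeight,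
        abs_of_nonneg (sub_nonneg.2 hs), ContinuousMap.coe_mk, Bool.false_eq_true, if_false]
      congr 2
      ring
  · intro z z' hzz
    obtain ⟨⟨y, s⟩, rfl⟩ := suspMk_surjective z
    obtain ⟨⟨y', s'⟩, rfl⟩ := suspMk_surjective z'
    simp only [ψ, suspLift_mk, ψ₀, ContinuousMap.coe_mk] at hzz
    obtain ⟨h1, h2⟩ := Fin.cons_injective2 hzz
    obtain rfl : s = s' := Subtype.ext h1
    by_cases hs : suspWeight s = 0
    · have : suspMk (y, s) = suspMk (y', s) := by
        rw [suspMk_eq_iff]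
        rcases suspWeight_eq_zero hs with rfl | rfl
        · exact Or.inr (Or.inl ⟨rfl, rfl⟩)
        · exact Or.inr (Or.inr ⟨rfl, rfl⟩)
      rw [this]
      exact hUd _
    · exact hφU y y' (smul_right_injective _ hs h2) s

/-- A continuous odd function of two points that vanishes at most on the diagonal. -/
def IsOddSep {X E : Type} [TopologicalSpace X] [NormedAddCommGroup E] (F : C(X × X, E)) : Prop :=
  (∀ x y, F (y, x) = - F (x, y)) ∧ ∀ x y, F (x, y) = 0 → x = y

/-- The difference function of a map. -/
def diffMap {X E : Type} [TopologicalSpace X] [NormedAddCommGroup E] (f : C(X, E)) :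
    C(X × X, E) := ⟨fun z => f z.1 - f z.2, by fun_prop⟩

@[simp] theorem diffMap_apply {X E : Type} [TopologicalSpace X] [NormedAddCommGroup E]
    (f : C(X, E)) (z : X × X) : diffMap f z = f z.1 - f z.2 := rfl

/-- The piecewise linear function that is `0` up to `a` and `1` from `b` on. -/
noncomputable def ramp (a b : ℝ) : C(ℝ, ℝ) := ⟨fun u => max 0 (min 1 ((u - a) / (b - a))), by
  fun_prop⟩

theorem ramp_nonneg (a b u : ℝ) : 0 ≤ ramp a b u := le_max_left _ _

theorem ramp_le_one (a b u : ℝ) : ramp a b u ≤ 1 :=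
  max_le zero_le_one (min_le_left _ _)

theorem ramp_of_le {a b u : ℝ} (hab : a < b) (h : u ≤ a) : ramp a b u = 0 := by
  have : (u - a) / (b - a) ≤ 0 := div_nonpos_of_nonpos_of_nonneg (by linarith) (by linarith)
  simp only [ramp, ContinuousMap.coe_mk]
  exact max_eq_left ((min_le_right _ _).trans this)

theorem ramp_of_ge {a b u : ℝ} (hab : a < b) (h : b ≤ u) : ramp a b u = 1 := by
  have : 1 ≤ (u - a) / (b - a) := (one_le_div (by linarith)).2 (by linarith)
  simp [ramp, min_eq_left this]

theorem euclidean_norm_le {m : ℕ} {v : EuclideanSpace ℝ (Fin m)} {b : ℝ} (hb : 0 ≤ b)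
    (h : ∀ j, |v j| ≤ b) : ‖v‖ ≤ m * b := by
  rw [EuclideanSpace.norm_eq]
  have h1 : ∑ j, ‖v j‖ ^ 2 ≤ (∑ j, ‖v j‖) ^ 2 :=
    Finset.sum_sq_le_sq_sum_of_nonneg fun j _ => norm_nonneg _
  have h2 : ∑ j, ‖v j‖ ≤ m * b := by
    calc ∑ j, ‖v j‖ ≤ ∑ _j : Fin m, b := Finset.sum_le_sum fun j _ => h j
      _ = m * b := by simp
  calc √(∑ j, ‖v j‖ ^ 2) ≤ √((∑ j, ‖v j‖) ^ 2) := Real.sqrt_le_sqrt h1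
    _ = ∑ j, ‖v j‖ := Real.sqrt_sq (Finset.sum_nonneg fun j _ => norm_nonneg _)
    _ ≤ _ := h2

theorem IsOddSep.exists_le_norm {X E : Type} [MetricSpace X] [CompactSpace X]
    [NormedAddCommGroup E] {F : C(X × X, E)} (hF : IsOddSep F) {r : ℝ} (hr : 0 < r) :
    ∃ c > 0, ∀ x y, r ≤ dist x y → c ≤ ‖F (x, y)‖ := by
  have hK : IsCompact {z : X × X | r ≤ dist z.1 z.2} :=
    (isClosed_le continuous_const (by fun_prop)).isCompact
  obtain ⟨c, hc, h⟩ := hK.exists_forall_le' (f := fun z => ‖F z‖) (a := 0) (by fun_prop) (by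
    rintro ⟨x, y⟩ hxy
    refine norm_pos_iff.2 fun h0 => ?_
    have := hF.2 x y h0
    simp only [Set.mem_ofPred_eq, this, dist_self] at hxy
    linarith)
  exact ⟨c, hc, fun x y hxy => h (x, y) hxy⟩

/-- Coordinatewise interpolation between two maps to Euclidean space. -/
def coordMix {Z : Type} [TopologicalSpace Z] {m : ℕ} (c : Fin m → C(Z, ℝ))
    (F G : C(Z, EuclideanSpace ℝ (Fin m))) : C(Z, EuclideanSpace ℝ (Fin m)) :=
  ⟨fun z => WithLp.toLp 2 fun j => F z j + c j z * (G z j - F z j),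
    (PiLp.continuous_toLp 2 _).comp (continuous_pi fun j => by fun_prop)⟩

@[simp] theorem coordMix_apply {Z : Type} [TopologicalSpace Z] {m : ℕ} (c : Fin m → C(Z, ℝ))
    (F G : C(Z, EuclideanSpace ℝ (Fin m))) (z : Z) (j : Fin m) :
    coordMix c F G z j = F z j + c j z * (G z j - F z j) := rfl

theorem coordMix_odd {X : Type} [TopologicalSpace X] {m : ℕ} {c : Fin m → C(X × X, ℝ)}
    (hc : ∀ j x y, c j (y, x) = c j (x, y)) {F G : C(X × X, EuclideanSpace ℝ (Fin m))}
    (hF : ∀ x y, F (y, x) = - F (x, y)) (hG : ∀ x y, G (y, x) = - G (x, y)) (x y : X) :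
    coordMix c F G (y, x) = - coordMix c F G (x, y) := by
  ext j
  simp only [coordMix_apply, PiLp.neg_apply, hc j x y, hF x y, hG x y]
  ring

theorem diffMap_odd {X E : Type} [TopologicalSpace X] [NormedAddCommGroup E] (f : C(X, E))
    (x y : X) : diffMap f (y, x) = - diffMap f (x, y) := by simp

/-- The ramp of the distance. -/
noncomputable def distRamp (X : Type) [MetricSpace X] (a b : ℝ) : C(X × X, ℝ) :=
  ⟨fun z => ramp a b (dist z.1 z.2), by fun_prop⟩

@[simp] theorem distRamp_apply {X : Type} [MetricSpace X] (a b : ℝ) (z : X × X) :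
    distRamp X a b z = ramp a b (dist z.1 z.2) := rfl

section Coord
variable {X : Type} [MetricSpace X] [CompactSpace X] {m n : ℕ}

/-- Signed version of the separation property: the difference of `u` has the sign of `F` in the
`k`-th coordinate wherever all other coordinates of `F` vanish. -/
theorem exists_sign_function {r : ℝ} {k : Fin m} {F : C(X × X, EuclideanSpace ℝ (Fin m))}
    (hodd : ∀ x y, F (y, x) = - F (x, y))
    (h : ∀ x y z, r ≤ dist x y → r ≤ dist x z → (∀ j ≠ k, F (x, y) j = 0) →
      (∀ j ≠ k, F (x, z) j = 0) → 0 ≤ F (x, y) k → F (x, z) k ≤ 0 → False) :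
    ∃ g : C(X, ℝ), (∀ x, |g x| ≤ 1) ∧ ∀ x y, r ≤ dist x y → (∀ j ≠ k, F (x, y) j = 0) →
      0 ≤ F (x, y) k → g x = 1 ∧ g y = -1 := by
  have hFc : ∀ j, Continuous fun z => F z j := fun j => by fun_prop
  let Z : Set (X × X) := {z | r ≤ dist z.1 z.2 ∧ ∀ j ≠ k, F z j = 0}
  have hZ : IsClosed Z := by
    have hd : IsClosed {z : X × X | r ≤ dist z.1 z.2} :=
      isClosed_le continuous_const (by fun_prop)
    have hZ : Z = {z | r ≤ dist z.1 z.2} ∩ ⋂ j, ⋂ (_ : j ≠ k), {z | F z j = 0} := by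
      ext z
      simp [Z]
    rw [hZ]
    exact hd.inter <| isClosed_iInter fun j => isClosed_iInter fun _ =>
      isClosed_eq (hFc j) continuous_const
  have hp : IsClosed (Prod.fst '' (Z ∩ {z | 0 ≤ F z k})) :=
    isClosedMap_fst_of_compactSpace _ (hZ.inter (isClosed_le continuous_const (hFc k)))
  have hn : IsClosed (Prod.fst '' (Z ∩ {z | F z k ≤ 0})) :=
    isClosedMap_fst_of_compactSpace _ (hZ.inter (isClosed_le (hFc k) continuous_const))
  obtain ⟨g, hg0, hg1, hg⟩ := exists_bounded_mem_Icc_of_closed_of_le hn hp (by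
    rw [Set.disjoint_left]
    rintro _ ⟨⟨x, z⟩, ⟨hz, hz'⟩, rfl⟩ ⟨⟨x', y⟩, ⟨hy, hy'⟩, hx⟩
    obtain rfl : x' = x := hx
    exact h x' y z hy.1 hz.1 hy.2 hz.2 hy' hz') (show (-1 : ℝ) ≤ 1 by norm_num)
  refine ⟨g, fun x => abs_le.2 (hg x), fun x y hxy hj hk => ⟨hg1 ⟨(x, y), ⟨⟨hxy, hj⟩, hk⟩, rfl⟩,
    hg0 ⟨(y, x), ⟨⟨?_, fun j hjk => ?_⟩, ?_⟩, rfl⟩⟩⟩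
  · rwa [dist_comm]
  · rw [hodd x y, PiLp.neg_apply, hj j hjk, neg_zero]
  · simp only [Set.mem_ofPred_eq]
    rw [hodd x y, PiLp.neg_apply]
    linarith

theorem exists_exact_coord (hX : DimProp X n) (hm : 3 * n < 2 * (m - 1)) (k : Fin m)
    {f : C(X, EuclideanSpace ℝ (Fin m))} {F : C(X × X, EuclideanSpace ℝ (Fin m))}
    (hF : IsOddSep F) {t r₀ r₁ : ℝ} (ht : 0 < t) (hr₀ : 0 < r₀) (hr : r₀ < r₁)
    (htol : ∀ z j, |F z j - diffMap f z j| ≤ t)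
    (hex : ∀ j < k, ∀ x y, r₀ ≤ dist x y → F (x, y) j = diffMap f (x, y) j) :
    ∃ (f' : C(X, EuclideanSpace ℝ (Fin m))) (F' : C(X × X, EuclideanSpace ℝ (Fin m))),
      IsOddSep F' ∧ (∀ z j, |F' z j - diffMap f' z j| ≤ 4 * t) ∧
      (∀ x j, |f' x j - f x j| ≤ 2 * t) ∧
      ∀ j ≤ k, ∀ x y, r₁ ≤ dist x y → F' (x, y) j = diffMap f' (x, y) j := by
  obtain ⟨c, hc, hcF⟩ := hF.exists_le_norm hr₀
  obtain ⟨M, hM0, hM⟩ : ∃ M > 0, ∀ z, ‖F z‖ ≤ M :=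
    ⟨‖F‖ + 1, by positivity, fun z => (F.norm_coe_le_norm z).trans (by linarith)⟩
  -- the size of the generic perturbation
  obtain ⟨e, he, het, hec⟩ : ∃ e > 0, 4 * e ≤ t ∧ 2 * (m * e) ≤ c := by
    refine ⟨min (t / 4) (c / (2 * (m + 1))), by positivity, ?_, ?_⟩
    · linarith [min_le_left (t / 4) (c / (2 * (m + 1)))]
    · have h1 := min_le_right (t / 4) (c / (2 * ((m : ℝ) + 1)))
      have h2 : 2 * ((m + 1) * min (t / 4) (c / (2 * ((m : ℝ) + 1)))) ≤ c := by
        calc _ ≤ 2 * (((m : ℝ) + 1) * (c / (2 * (m + 1)))) := by gcongr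
          _ = c := by field_simp
      have h3 : 0 < min (t / 4) (c / (2 * ((m : ℝ) + 1))) := by positivity
      nlinarith
  obtain ⟨ε, hε, hε1, hε2, hε3⟩ : ∃ ε > 0, 4 * ε ≤ e ∧ 2 * (ε * M) ≤ e ∧ ε < 1 := by
    refine ⟨min (min (e / 4) (e / (2 * M))) (1 / 2), by positivity, ?_, ?_, ?_⟩
    · linarith [(min_le_left (min (e / 4) (e / (2 * M))) (1 / 2)).trans (min_le_left _ _)]
    · have := (min_le_left (min (e / 4) (e / (2 * M))) (1 / 2)).trans (min_le_right _ _)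
      calc _ ≤ 2 * (e / (2 * M) * M) := by gcongr
        _ = e := by field_simp
    · linarith [min_le_right (min (e / 4) (e / (2 * M))) (1 / 2)]
  obtain ⟨f₁, F₁, hodd₁, hf₁, hF₁, hgen⟩ := exists_general_position hX hF.1 hF.2 f hε
    (ι := Unit) (fun _ => 3) (fun _ => 0) (fun _ => coordSet k)
    (fun _ => removable_coordSet k hm)
  have hF₁0 : ∀ x y, F₁ (x, y) = 0 → x = y := by
    intro x y h0
    have := hF₁ (x, y)
    rw [h0, zero_sub, norm_neg] at this
    refine hF.2 x y (norm_eq_zero.1 (le_antisymm ?_ (norm_nonneg _)))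
    nlinarith [norm_nonneg (F (x, y))]
  have hf₁j : ∀ x j, |f₁ x j - f x j| ≤ ε := fun x j =>
    (PiLp.norm_apply_le (f₁ x - f x) j).trans (hf₁ x)
  have hF₁j : ∀ z j, |F₁ z j - F z j| ≤ e / 2 := fun z j => by
    refine (PiLp.norm_apply_le (F₁ z - F z) j).trans ((hF₁ z).trans ?_)
    have : ε * ‖F z‖ ≤ ε * M := by gcongr; exact hM z
    linarith
  have ha₁j : ∀ z j, |diffMap f₁ z j - diffMap f z j| ≤ e / 2 := fun z j => by
    have h1 := hf₁j z.1 j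
    have h2 := hf₁j z.2 j
    simp only [diffMap_apply, PiLp.sub_apply]
    rw [abs_le] at *
    constructor <;> linarith
  have htol₁ : ∀ z j, |F₁ z j - diffMap f₁ z j| ≤ 5 / 4 * t := fun z j => by
    have h1 := htol z j
    have h2 := hF₁j z j
    have h3 := ha₁j z j
    rw [abs_le] at *
    constructor <;> linarith
  obtain ⟨r', hr', hr''⟩ := exists_between hr
  let χ : Fin m → C(X × X, ℝ) := fun j => if j < k then distRamp X r₀ r' else 0
  have hχ : ∀ j z, 0 ≤ χ j z ∧ χ j z ≤ 1 := fun j z => by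
    simp only [χ]
    split_ifs
    · exact ⟨ramp_nonneg _ _ _, ramp_le_one _ _ _⟩
    · simp
  let F₂ := coordMix χ F₁ (diffMap f₁)
  have hodd₂ : ∀ x y, F₂ (y, x) = - F₂ (x, y) :=
    coordMix_odd (fun j x y => by simp only [χ]; split_ifs <;> simp [dist_comm]) hodd₁
      (diffMap_odd f₁)
  have hF₂hi : ∀ j, ¬ j < k → ∀ z, F₂ z j = F₁ z j := fun j hj z => by simp [F₂, χ, hj]
  have hF₂lo : ∀ j < k, ∀ x y, r' ≤ dist x y → F₂ (x, y) j = diffMap f₁ (x, y) j :=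
    fun j hj x y hxy => by
      have := ramp_of_ge hr' hxy
      simp [F₂, χ, hj, this]
  have hF₂0 : ∀ x y, F₂ (x, y) = 0 → x = y := by
    intro x y h0
    rcases le_total (dist x y) r₀ with hd | hd
    · refine hF₁0 x y ?_
      rw [← h0]
      ext j
      have := ramp_of_le hr' hd
      simp only [F₂, coordMix_apply, χ]
      split_ifs <;> simp [this]
    · exfalso
      have hsmall : ∀ j, |F (x, y) j| ≤ e := fun j => by
        have h1 := hF₁j (x, y) j
        have h2 := ha₁j (x, y) j
        have h3 : F₂ (x, y) j = 0 := by rw [h0]; rfl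
        by_cases hj : j < k
        · rw [← hex j hj x y hd] at h2
          have h4 := hχ j (x, y)
          simp only [F₂, coordMix_apply] at h3
          rw [abs_le] at *
          constructor <;> nlinarith
        · rw [hF₂hi j hj] at h3
          rw [h3, abs_le] at h1
          rw [abs_le]
          constructor <;> linarith
      have h1 := euclidean_norm_le he.le hsmall
      have h2 := hcF x y hd
      linarith
  have htol₂ : ∀ z j, |F₂ z j - diffMap f₁ z j| ≤ 5 / 4 * t := fun z j => by
    have h1 := htol₁ z j
    have h2 := hχ j z
    have h3 : F₂ z j - diffMap f₁ z j = (1 - χ j z) * (F₁ z j - diffMap f₁ z j) := by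
      simp only [F₂, coordMix_apply]; ring
    rw [h3, abs_mul, abs_of_nonneg (by linarith)]
    nlinarith [abs_nonneg (F₁ z j - diffMap f₁ z j)]
  have hvec : ∀ x y, (∀ j ≠ k, F₂ (x, y) j = 0) → F₂ (x, y) k = 0 → x = y := fun x y h h' =>
    hF₂0 x y (by ext j; by_cases hj : j = k; exacts [hj ▸ h', h j hj])
  have hr'0 : 0 < r' := hr₀.trans hr'
  obtain ⟨g, hg1, hg⟩ := exists_sign_function (r := r') (k := k) hodd₂ (by
    intro x y z hxy hxz hy hz hyk hzk
    have hne : ∀ {u v : X}, r' ≤ dist u v → u ≠ v := by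
      rintro u v huv rfl
      rw [dist_self] at huv
      linarith
    have hyz : y ≠ z := by
      rintro rfl
      exact hne hxy (hvec x y hy (le_antisymm hzk hyk))
    refine hgen () ![x, y, z] ?_ Fin.elim0 ⟨fun j hj => ?_, fun j hj => ?_⟩
    · intro a b
      fin_cases a <;> fin_cases b <;>
        simp [hne hxy, hne hxz, hyz, (hne hxy).symm, (hne hxz).symm, hyz.symm]
    · have h1 := hF₂lo j hj x y hxy
      have h2 := hF₂lo j hj x z hxz
      rw [hy j hj.ne] at h1
      rw [hz j hj.ne] at h2
      simp only [diffMap_apply, PiLp.sub_apply] at h1 h2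
      exact ⟨by simp [pairVals]; linarith, by simp [pairVals]; linarith⟩
    · have h1 := hF₂hi j hj.le.not_gt (x, y)
      have h2 := hF₂hi j hj.le.not_gt (x, z)
      rw [hy j hj.ne'] at h1
      rw [hz j hj.ne'] at h2
      exact ⟨by simp [pairVals, ← h1], by simp [pairVals, ← h2]⟩)
  let f' : C(X, EuclideanSpace ℝ (Fin m)) :=
    coordMix (fun j => if j = k then 1 else 0) f₁
      (f₁ + ⟨fun x => WithLp.toLp 2 fun _ => 5 / 4 * t * g x,
        (PiLp.continuous_toLp 2 _).comp (by fun_prop)⟩)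
  have hf'k : ∀ x, f' x k = f₁ x k + 5 / 4 * t * g x := fun x => by simp [f']
  have hf'j : ∀ x, ∀ j ≠ k, f' x j = f₁ x j := fun x j hj => by simp [f', hj]
  let ℓ : Fin m → C(X × X, ℝ) := fun j => if j = k then distRamp X r' r₁ else 0
  have hℓ : ∀ z : X × X, 0 ≤ ramp r' r₁ (dist z.1 z.2) ∧ ramp r' r₁ (dist z.1 z.2) ≤ 1 := fun z =>
    ⟨ramp_nonneg _ _ _, ramp_le_one _ _ _⟩
  let F' := coordMix ℓ F₂ (diffMap f')
  have hF'k : ∀ z, F' z k = F₂ z k + ramp r' r₁ (dist z.1 z.2) * (diffMap f' z k - F₂ z k) :=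
    fun z => by simp [F', ℓ]
  have hF'j : ∀ z, ∀ j ≠ k, F' z j = F₂ z j := fun z j hj => by simp [F', ℓ, hj]
  have hodd' : ∀ x y, F' (y, x) = - F' (x, y) :=
    coordMix_odd (fun j x y => by simp only [ℓ]; split_ifs <;> simp [dist_comm]) hodd₂
      (diffMap_odd f')
  have hpos : ∀ x y, F' (x, y) = 0 → 0 ≤ F₂ (x, y) k → x = y := by
    intro x y h0 hk
    have hj : ∀ j ≠ k, F₂ (x, y) j = 0 := fun j hj => by rw [← hF'j (x, y) j hj, h0]; rfl
    have h0k : F' (x, y) k = 0 := by rw [h0]; rfl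
    rw [hF'k] at h0k
    rcases le_total (dist x y) r' with hd | hd
    · exact hvec x y hj (by simpa [ramp_of_le hr'' hd] using h0k)
    · obtain ⟨h1, h2⟩ := hg x y hd hj hk
      have h3 := htol₂ (x, y) k
      have h4 : diffMap f' (x, y) k = diffMap f₁ (x, y) k + 5 / 2 * t := by
        simp only [diffMap_apply, PiLp.sub_apply, hf'k, h1, h2]; ring
      have h5 := hℓ (x, y)
      refine hvec x y hj (le_antisymm ?_ hk)
      rw [abs_le] at h3
      simp only [h4] at h0k h5
      set l := ramp r' r₁ (dist x y)
      have h6 : l = 0 := by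
        refine le_antisymm ?_ h5.1
        by_contra hl
        nlinarith [mul_nonneg (sub_nonneg.2 h5.2) hk,
          mul_pos (not_le.1 hl) (show 0 < diffMap f₁ (x, y) k + 5 / 2 * t by linarith)]
      rw [h6] at h0k
      linarith
  refine ⟨f', F', ⟨hodd', fun x y h0 => ?_⟩, fun z j => ?_, fun x j => ?_,
    fun j hj x y hxy => ?_⟩
  · rcases le_total 0 (F₂ (x, y) k) with h | h
    · exact hpos x y h0 h
    · refine (hpos y x (by rw [hodd', h0, neg_zero]) ?_).symm
      rw [hodd₂, PiLp.neg_apply]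
      linarith
  · by_cases hj : j = k
    · subst hj
      have h1 := htol₂ z j
      have h2 := hℓ z
      have h3 := abs_le.1 (hg1 z.1)
      have h4 := abs_le.1 (hg1 z.2)
      have h5 : F' z j - diffMap f' z j = (1 - ramp r' r₁ (dist z.1 z.2)) *
          ((F₂ z j - diffMap f₁ z j) - 5 / 4 * t * (g z.1 - g z.2)) := by
        rw [hF'k]
        simp only [diffMap_apply, PiLp.sub_apply, hf'k]
        ring
      have h6 : |(F₂ z j - diffMap f₁ z j) - 5 / 4 * t * (g z.1 - g z.2)| ≤ 4 * t := by
        rw [abs_le] at *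
        constructor <;> nlinarith
      rw [h5, abs_mul, abs_of_nonneg (by linarith)]
      nlinarith [abs_nonneg ((F₂ z j - diffMap f₁ z j) - 5 / 4 * t * (g z.1 - g z.2))]
    · rw [hF'j z j hj]
      have := htol₂ z j
      simp only [diffMap_apply, PiLp.sub_apply, hf'j _ j hj] at this ⊢
      linarith
  · have h1 := hf₁j x j
    by_cases hj : j = k
    · subst hj
      have h3 := abs_le.1 (hg1 x)
      rw [hf'k]
      rw [abs_le] at *
      constructor <;> nlinarith
    · rw [hf'j x j hj]
      linarith
  · rcases hj.lt_or_eq with hj | rfl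
    · rw [hF'j _ j hj.ne, hF₂lo j hj x y (hr''.le.trans hxy)]
      simp only [diffMap_apply, PiLp.sub_apply, hf'j _ j hj.ne]
    · rw [hF'k, ramp_of_ge hr'' hxy]
      ring

theorem exists_exact_of_close (hX : DimProp X n) (hm : 3 * n < 2 * (m - 1))
    {f : C(X, EuclideanSpace ℝ (Fin m))} {F : C(X × X, EuclideanSpace ℝ (Fin m))}
    (hF : IsOddSep F) {t r : ℝ} (ht : 0 < t) (hr : 0 < r) (htol : ∀ z, ‖F z - diffMap f z‖ ≤ t) :
    ∃ (f' : C(X, EuclideanSpace ℝ (Fin m))) (F' : C(X × X, EuclideanSpace ℝ (Fin m))),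
      IsOddSep F' ∧ (∀ z, ‖F' z - diffMap f' z‖ ≤ m * (4 ^ m * t)) ∧
      (∀ x, ‖f' x - f x‖ ≤ m * (4 ^ m * t)) ∧
      ∀ x y, r ≤ dist x y → F' (x, y) = diffMap f' (x, y) := by
  have key : ∀ i ≤ m, ∃ (f' : C(X, EuclideanSpace ℝ (Fin m)))
      (F' : C(X × X, EuclideanSpace ℝ (Fin m))), IsOddSep F' ∧
      (∀ z j, |F' z j - diffMap f' z j| ≤ 4 ^ i * t) ∧ (∀ x j, |f' x j - f x j| ≤ 4 ^ i * t) ∧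
      ∀ j : Fin m, j < i → ∀ x y, r * ((i + 1) / (m + 1)) ≤ dist x y →
        F' (x, y) j = diffMap f' (x, y) j := by
    intro i
    induction i with
    | zero =>
      refine fun _ => ⟨f, F, hF, fun z j => ?_, fun x j => by simpa using ht.le, by simp⟩
      simpa using (PiLp.norm_apply_le (F z - diffMap f z) j).trans (htol z)
    | succ i ih =>
      intro hi
      obtain ⟨f₁, F₁, hF₁, htol₁, hf₁, hex⟩ := ih (by omega)
      obtain ⟨f', F', hF', htol', hf', hex'⟩ := exists_exact_coord hX hm ⟨i, hi⟩ hF₁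
        (t := 4 ^ i * t) (r₀ := r * ((i + 1) / (m + 1))) (r₁ := r * (((i + 1 : ℕ) + 1) / (m + 1)))
        (by positivity) (by positivity) (by push_cast; gcongr; linarith) htol₁
        (fun j hj => hex j hj)
      refine ⟨f', F', hF', fun z j => (htol' z j).trans_eq (by ring), fun x j => ?_,
        fun j hj => hex' j (Nat.lt_succ_iff.1 hj)⟩
      have h1 := abs_add_le (f' x j - f₁ x j) (f₁ x j - f x j)
      have h2 := hf₁ x j
      have h3 := hf' x j
      rw [sub_add_sub_cancel] at h1
      have : 0 < (4 : ℝ) ^ i * t := by positivity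
      rw [pow_succ]
      linarith
  obtain ⟨f', F', hF', htol', hf', hex⟩ := key m le_rfl
  refine ⟨f', F', hF', fun z => euclidean_norm_le (by positivity) (htol' z),
    fun x => euclidean_norm_le (by positivity) (hf' x), fun x y hxy => ?_⟩
  ext j
  refine hex j j.2 x y ?_
  rwa [div_self (by positivity), mul_one]
end Coord

theorem isOpen_imp_of_isClosed {A : Type} [TopologicalSpace A] {p q : A → Prop}
    (hp : IsClosed {a | p a}) (hq : IsOpen {a | q a}) : IsOpen {a | p a → q a} := by
  have : {a | p a → q a} = {a | p a}ᶜ ∪ {a | q a} := by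
    ext a
    simp [imp_iff_not_or]
  rw [this]
  exact hp.isOpen_compl.union hq

section Rays
variable {X E : Type} [MetricSpace X] [CompactSpace X] [NormedAddCommGroup E]
  [InnerProductSpace ℝ E] [FiniteDimensional ℝ E] {n : ℕ}

/-- The value of `F` at a pair points from one image to the other. -/
def IsBad (f : C(X, E)) (F : C(X × X, E)) (x y : X) : Prop := SameRay ℝ (F (x, y)) (f y - f x)

theorem isBad_iff {f : C(X, E)} {F : C(X × X, E)} {x y : X} :
    IsBad f F x y ↔ ‖F (x, y) + (f y - f x)‖ = ‖F (x, y)‖ + ‖f y - f x‖ :=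
  sameRay_iff_norm_add

theorem IsBad.symm {f : C(X, E)} {F : C(X × X, E)} (hF : IsOddSep F) {x y : X}
    (h : IsBad f F x y) : IsBad f F y x := by
  unfold IsBad at *
  rw [hF.1, ← neg_sub, sameRay_neg_iff]
  exact h

theorem IsBad.norm_le {f : C(X, E)} {F : C(X × X, E)} {s : ℝ} {x y : X}
    (hs : ‖F (x, y) - diffMap f (x, y)‖ ≤ s) (h : IsBad f F x y) : ‖f y - f x‖ ≤ s := by
  rw [isBad_iff] at h
  have : F (x, y) - diffMap f (x, y) = F (x, y) + (f y - f x) := by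
    rw [diffMap_apply]; abel
  rw [this, h] at hs
  linarith [norm_nonneg (F (x, y))]

/-- The segment between the images of `x` and `y` is one along which points are allowed to move. -/
def IsTrack (f : C(X, E)) (F : C(X × X, E)) (τ : ℝ) (x y : X) : Prop :=
  x = y ∨ (IsBad f F x y ∧ τ ≤ ‖f y - f x‖)

/-- Tracks starting at distant points are more than `μ` apart. -/
def TrackSep (f : C(X, E)) (F : C(X × X, E)) (τ r μ : ℝ) : Prop :=
  ∀ x y z w, ∀ s t : I, IsTrack f F τ x y → IsTrack f F τ z w → r ≤ dist x z →
    μ < ‖(f x + (s : ℝ) • (f y - f x)) - (f z + (t : ℝ) • (f w - f z))‖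

theorem TrackSep.mono {f : C(X, E)} {F : C(X × X, E)} {τ τ' r μ : ℝ} (h : TrackSep f F τ r μ)
    (hτ : τ ≤ τ') : TrackSep f F τ' r μ := fun x y z w s t h1 h2 =>
  h x y z w s t (h1.imp_right fun h => ⟨h.1, hτ.trans h.2⟩)
    (h2.imp_right fun h => ⟨h.1, hτ.trans h.2⟩)

theorem isClosed_isBad {A : Type} [TopologicalSpace A] {f : A → C(X, E)} {F : A → C(X × X, E)}
    {x y : A → X} (hf : Continuous f) (hF : Continuous F) (hx : Continuous x)
    (hy : Continuous y) : IsClosed {a | IsBad (f a) (F a) (x a) (y a)} := by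
  simp only [isBad_iff]
  exact isClosed_eq (by fun_prop) (by fun_prop)

theorem isClosed_isTrack {A : Type} [TopologicalSpace A] {f : A → C(X, E)}
    {F : A → C(X × X, E)} {x y : A → X} (hf : Continuous f) (hF : Continuous F)
    (hx : Continuous x) (hy : Continuous y) (τ : ℝ) :
    IsClosed {a | IsTrack (f a) (F a) τ (x a) (y a)} :=
  have h : IsClosed {a | τ ≤ ‖f a (y a) - f a (x a)‖} := isClosed_le (by fun_prop) (by fun_prop)
  (isClosed_eq hx hy).union ((isClosed_isBad hf hF hx hy).inter h)

theorem isOpen_bad_lt (τ : ℝ) : IsOpen {p : C(X, E) × C(X × X, E) |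
    ∀ x y, IsBad p.1 p.2 x y → ‖p.1 y - p.1 x‖ < τ} := by
  have hU : IsOpen {a : (C(X, E) × C(X × X, E)) × (X × X) |
      IsBad a.1.1 a.1.2 a.2.1 a.2.2 → ‖a.1.1 a.2.2 - a.1.1 a.2.1‖ < τ} := by
    refine isOpen_imp_of_isClosed (isClosed_isBad ?_ ?_ ?_ ?_) (isOpen_lt ?_ ?_) <;> fun_prop
  simpa only [Prod.forall, Set.mem_ofPred_eq] using isOpen_forall_of_compactSpace hU

theorem isOpen_not_bad (r : ℝ) : IsOpen {p : C(X, E) × C(X × X, E) |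
    ∀ x y, r ≤ dist x y → ¬ IsBad p.1 p.2 x y} := by
  have hU : IsOpen {a : (C(X, E) × C(X × X, E)) × (X × X) |
      r ≤ dist a.2.1 a.2.2 → ¬ IsBad a.1.1 a.1.2 a.2.1 a.2.2} := by
    refine isOpen_imp_of_isClosed (isClosed_le ?_ ?_)
      (isClosed_isBad ?_ ?_ ?_ ?_).isOpen_compl <;> fun_prop
  simpa only [Prod.forall, Set.mem_ofPred_eq] using isOpen_forall_of_compactSpace hU

theorem isOpen_trackSep (τ : ℝ) : IsOpen {p : (C(X, E) × C(X × X, E)) × ℝ × ℝ |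
    TrackSep p.1.1 p.1.2 τ p.2.1 p.2.2} := by
  have hU : IsOpen {a : ((C(X, E) × C(X × X, E)) × ℝ × ℝ) × (X × X × X × X × I × I) |
      IsTrack a.1.1.1 a.1.1.2 τ a.2.1 a.2.2.1 →
      IsTrack a.1.1.1 a.1.1.2 τ a.2.2.2.1 a.2.2.2.2.1 →
      a.1.2.1 ≤ dist a.2.1 a.2.2.2.1 →
      a.1.2.2 < ‖(a.1.1.1 a.2.1 + (a.2.2.2.2.2.1 : ℝ) • (a.1.1.1 a.2.2.1 - a.1.1.1 a.2.1)) -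
        (a.1.1.1 a.2.2.2.1 + (a.2.2.2.2.2.2 : ℝ) • (a.1.1.1 a.2.2.2.2.1 -
          a.1.1.1 a.2.2.2.1))‖} := by
    refine isOpen_imp_of_isClosed (isClosed_isTrack ?_ ?_ ?_ ?_ _)
      (isOpen_imp_of_isClosed (isClosed_isTrack ?_ ?_ ?_ ?_ _)
      (isOpen_imp_of_isClosed (isClosed_le ?_ ?_) (isOpen_lt ?_ ?_))) <;> fun_prop
  simpa only [Prod.forall, Set.mem_ofPred_eq, TrackSep] using isOpen_forall_of_compactSpace hU

/-- General position of a map and a two-point function with respect to rays. -/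
structure RayGeneric (f : C(X, E)) (F : C(X × X, E)) : Prop where
  two_rays : ∀ x y z, x ≠ y → x ≠ z → y ≠ z → ∀ a b : ℝ, F (x, y) = a • (f y - f x) →
    F (x, z) ≠ b • (f z - f x)
  third_point : ∀ x y z, x ≠ y → x ≠ z → y ≠ z → ∀ a b : ℝ, F (x, y) = a • (f y - f x) →
    f z ≠ f x + b • (f y - f x)
  crossing : ∀ x y z w, x ≠ y → x ≠ z → x ≠ w → y ≠ z → y ≠ w → z ≠ w → ∀ a b c d : ℝ,
    F (x, y) = a • (f y - f x) → F (z, w) = b • (f w - f z) →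
    f x + c • f y ≠ (1 + c) • (f z + d • (f w - f z))

theorem exists_rayGeneric (hX : DimProp X n) (h1 : 3 * n + 2 < 2 * Module.finrank ℝ E)
    (h2 : 4 * n + 4 < 3 * Module.finrank ℝ E) {f : C(X, E)} {F : C(X × X, E)} (hF : IsOddSep F)
    {U : Set (C(X, E) × C(X × X, E))} (hU : IsOpen U) (hfF : (f, F) ∈ U) {ε : ℝ} (hε : 0 < ε) :
    ∃ (f' : C(X, E)) (F' : C(X × X, E)), IsOddSep F' ∧ (f', F') ∈ U ∧
      (∀ x, ‖f' x - f x‖ ≤ ε) ∧ RayGeneric f' F' := by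
  obtain ⟨δ, hδ, hball⟩ := Metric.isOpen_iff.1 hU _ hfF
  obtain ⟨e, he, heε, he1, heδ, heδ'⟩ : ∃ e > 0, e ≤ ε ∧ e < 1 ∧ e < δ ∧ e * ‖F‖ < δ := by
    refine ⟨min (min ε (1 / 2)) (min (δ / 2) (δ / (2 * (‖F‖ + 1)))), by positivity,
      (min_le_left _ _).trans (min_le_left _ _), ?_, ?_, ?_⟩
    · exact ((min_le_left _ _).trans (min_le_right _ _)).trans_lt (by norm_num)
    · exact ((min_le_right _ _).trans (min_le_left _ _)).trans_lt (by linarith)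
    · calc _ ≤ δ / (2 * (‖F‖ + 1)) * ‖F‖ := by
            gcongr; exact (min_le_right _ _).trans (min_le_right _ _)
        _ ≤ δ / (2 * (‖F‖ + 1)) * (‖F‖ + 1) := by gcongr; linarith
        _ = δ / 2 := by field_simp
        _ < δ := by linarith
  obtain ⟨f', F', hodd, hf', hF', hgen⟩ := exists_general_position hX hF.1 hF.2 f he
    (ι := Option Bool) (fun i => match i with
      | none => 4
      | some _ => 3)
    (fun i => match i with
      | none => 4
      | some _ => 2)
    (fun i => match i with
      | none => crossingRaysSet E
      | some true => twoRaysSet E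
      | some false => thirdPointSet E)
    (fun i => match i with
      | none => removable_crossingRaysSet h2
      | some true => removable_twoRaysSet h1
      | some false => removable_thirdPointSet h1)
  have inj3 : ∀ x y z : X, x ≠ y → x ≠ z → y ≠ z → Function.Injective ![x, y, z] := by
    intro x y z hxy hxz hyz a b
    fin_cases a <;> fin_cases b <;> simp [hxy, hxz, hyz, hxy.symm, hxz.symm, hyz.symm]
  refine ⟨f', F', ⟨hodd, fun x y h0 => hF.2 x y ?_⟩, hball ?_, fun x => (hf' x).trans heε,
    ⟨?_, ?_, ?_⟩⟩
  · have := hF' (x, y)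
    rw [h0, zero_sub, norm_neg] at this
    exact norm_eq_zero.1 (le_antisymm (by nlinarith [norm_nonneg (F (x, y))]) (norm_nonneg _))
  · rw [mem_ball, Prod.dist_eq, max_lt_iff]
    constructor
    · refine (ContinuousMap.dist_lt_iff hδ).2 fun x => ?_
      rw [dist_eq_norm]
      exact (hf' x).trans_lt heδ
    · refine (ContinuousMap.dist_lt_iff hδ).2 fun z => ?_
      rw [dist_eq_norm]
      refine ((hF' z).trans ?_).trans_lt heδ'
      gcongr
      exact F.norm_coe_le_norm z
  · intro x y z hxy hxz hyz a b ha hb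
    exact hgen (some true) ![x, y, z] (inj3 x y z hxy hxz hyz) ![a, b]
      ⟨by simpa [pairVals] using ha, by simpa [pairVals] using hb⟩
  · intro x y z hxy hxz hyz a b ha hb
    exact hgen (some false) ![x, y, z] (inj3 x y z hxy hxz hyz) ![a, b]
      ⟨by simpa [pairVals] using ha, by simpa [pairVals] using hb⟩
  · intro x y z w hxy hxz hxw hyz hyw hzw a b c d ha hb hc
    refine hgen none ![x, y, z, w] ?_ ![a, b, c, d]
      ⟨by simpa [pairVals] using ha, by simpa [pairVals] using hb, by simpa [pairVals] using hc⟩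
    intro i j
    fin_cases i <;> fin_cases j <;> simp [hxy, hxz, hxw, hyz, hyw, hzw, hxy.symm, hxz.symm,
      hxw.symm, hyz.symm, hyw.symm, hzw.symm]

theorem IsBad.exists_eq_smul {f : C(X, E)} {F : C(X × X, E)} {x y : X} (h : IsBad f F x y)
    (hne : f y ≠ f x) : ∃ a : ℝ, F (x, y) = a • (f y - f x) := by
  obtain ⟨a, -, ha⟩ := SameRay.exists_nonneg_right h (sub_ne_zero.2 hne)
  exact ⟨a, ha⟩

theorem RayGeneric.trackSep {f : C(X, E)} {F : C(X × X, E)} (hF : IsOddSep F)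
    (hg : RayGeneric f F) {r : ℝ} (hr : 0 < r) (hbad : ∀ x y, r ≤ dist x y → ¬ IsBad f F x y) :
    TrackSep f F 0 r 0 := by
  have hne : ∀ {u v : X}, r ≤ dist u v → u ≠ v := by
    rintro u v huv rfl
    rw [dist_self] at huv
    linarith
  have hred : ∀ x y, ∀ s : I, IsTrack f F 0 x y →
      f x + (s : ℝ) • (f y - f x) = f x ∨ (IsBad f F x y ∧ f y ≠ f x) := by
    rintro x y s (rfl | ⟨h, -⟩)
    · simp
    · by_cases h' : f y = f x
      · simp [h']
      · exact Or.inr ⟨h, h'⟩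
  have hmix : ∀ x y z, ∀ s : ℝ, IsBad f F x y → f y ≠ f x → r ≤ dist x z →
      f z ≠ f x + s • (f y - f x) := by
    intro x y z s hb hxy hxz hz
    obtain ⟨a, ha⟩ := hb.exists_eq_smul hxy
    have hyz : y ≠ z := by
      rintro rfl
      exact hbad x y hxz hb
    exact hg.third_point x y z (fun h => hxy (by rw [h])) (hne hxz) hyz a s ha hz
  intro x y z w s t hxy hzw hxz
  rw [norm_pos_iff, sub_ne_zero]
  intro heq
  rcases hred x y s hxy with h1 | ⟨h1, h1'⟩ <;> rcases hred z w t hzw with h2 | ⟨h2, h2'⟩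
  · rw [h1, h2] at heq
    refine hbad x z hxz ?_
    simp [IsBad, heq]
  · rw [h1] at heq
    exact hmix z w x t h2 h2' (by rwa [dist_comm]) heq
  · rw [h2] at heq
    exact hmix x y z s h1 h1' hxz heq.symm
  · have hxy' : x ≠ y := fun h => h1' (by rw [h])
    have hzw' : z ≠ w := fun h => h2' (by rw [h])
    have hyz : y ≠ z := by
      rintro rfl
      exact hbad x y hxz h1
    have hxw : x ≠ w := by
      rintro rfl
      exact hbad z x (by rwa [dist_comm]) h2
    obtain ⟨a, ha⟩ := h1.exists_eq_smul h1'
    obtain ⟨b, hb⟩ := h2.exists_eq_smul h2'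
    have hyw : y ≠ w := by
      rintro rfl
      obtain ⟨a', ha'⟩ := (h1.symm hF).exists_eq_smul h1'.symm
      obtain ⟨b', hb'⟩ := (h2.symm hF).exists_eq_smul h2'.symm
      exact hg.two_rays y x z hxy'.symm hyz (hne hxz) a' b' ha' hb'
    rcases s.2.2.lt_or_eq with hs | hs
    · refine hg.crossing x y z w hxy' (hne hxz) hxw hyz hyw hzw' a b (s / (1 - s)) t ha hb ?_
      have h3 : (1 - (s : ℝ)) ≠ 0 := by linarith
      rw [← heq]
      have h4 : 1 + (s : ℝ) / (1 - s) = (1 - s : ℝ)⁻¹ := by field_simp; ring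
      have h5 : f x + (s : ℝ) • (f y - f x) = (1 - (s : ℝ)) • f x + (s : ℝ) • f y := by module
      rw [h4, h5, smul_add, smul_smul, smul_smul, inv_mul_cancel₀ h3, one_smul, div_eq_inv_mul]
    · rw [hs, one_smul, add_sub_cancel] at heq
      exact hg.third_point z w y hzw' hyz.symm hyw.symm b t hb heq

theorem exists_trackSep (hX : DimProp X n) (h1 : 3 * n + 2 < 2 * Module.finrank ℝ E)
    (h2 : 4 * n + 4 < 3 * Module.finrank ℝ E) {f : C(X, E)} {F : C(X × X, E)} (hF : IsOddSep F)
    {r τ ε : ℝ} (hr : 0 < r) (hε : 0 < ε) (hbad : ∀ x y, r ≤ dist x y → ¬ IsBad f F x y)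
    (hτ : ∀ x y, IsBad f F x y → ‖f y - f x‖ < τ) :
    ∃ (f' : C(X, E)) (F' : C(X × X, E)), IsOddSep F' ∧ (∀ x, ‖f' x - f x‖ ≤ ε) ∧
      (∀ x y, IsBad f' F' x y → ‖f' y - f' x‖ < τ) ∧ ∃ μ > 0, TrackSep f' F' 0 r μ := by
  obtain ⟨f', F', hF', hU, hf', hgen⟩ := exists_rayGeneric hX h1 h2 hF
    ((isOpen_bad_lt τ).inter (isOpen_not_bad r)) ⟨hτ, hbad⟩ hε
  refine ⟨f', F', hF', hf', hU.1, ?_⟩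
  have hopen : IsOpen {μ : ℝ | TrackSep f' F' 0 r μ} :=
    (isOpen_trackSep 0).preimage (f := fun μ : ℝ => ((f', F'), r, μ)) (by fun_prop)
  obtain ⟨δ, hδ, hball⟩ := Metric.isOpen_iff.1 hopen 0 (hgen.trackSep hF' hr hU.2)
  exact ⟨δ / 2, by positivity, hball (by simp [abs_of_pos hδ, hδ])⟩

end Rays

section Shear
variable {E : Type} [NormedAddCommGroup E] [InnerProductSpace ℝ E]

theorem sameRay_shear_iff {a c : E} (h : ‖c‖ < ‖a‖) (u v : E) :
    SameRay ℝ (u + ((‖a‖ ^ 2)⁻¹ * inner ℝ a u) • c) (v + ((‖a‖ ^ 2)⁻¹ * inner ℝ a v) • c) ↔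
      SameRay ℝ u v := by
  let T : E →ₗ[ℝ] E := LinearMap.id + (‖a‖ ^ 2)⁻¹ • (innerₛₗ ℝ a).smulRight c
  have hT : ∀ v, T v = v + ((‖a‖ ^ 2)⁻¹ * inner ℝ a v) • c := fun v => by
    simp [T, smul_smul]
  have ha : 0 < ‖a‖ := (norm_nonneg c).trans_lt h
  have hinj : Function.Injective T := by
    rw [← LinearMap.ker_eq_bot, LinearMap.ker_eq_bot']
    intro v hv
    rw [hT, add_eq_zero_iff_eq_neg] at hv
    have h1 : ‖v‖ ≤ ‖c‖ / ‖a‖ * ‖v‖ := by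
      calc ‖v‖ = ‖((‖a‖ ^ 2)⁻¹ * inner ℝ a v) • c‖ := by conv_lhs => rw [hv, norm_neg]
        _ = (‖a‖ ^ 2)⁻¹ * |inner ℝ a v| * ‖c‖ := by
          rw [norm_smul, norm_mul, norm_inv, norm_pow, norm_norm, Real.norm_eq_abs]
        _ ≤ (‖a‖ ^ 2)⁻¹ * (‖a‖ * ‖v‖) * ‖c‖ := by
          gcongr
          exact abs_real_inner_le_norm a v
        _ = ‖c‖ / ‖a‖ * ‖v‖ := by field_simp
    have h2 : ‖c‖ / ‖a‖ < 1 := (div_lt_one ha).2 h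
    by_contra hne
    have h3 := norm_pos_iff.2 hne
    nlinarith
  rw [← hT, ← hT]
  exact hinj.sameRay_map_iff

end Shear

section Step
variable {X E : Type} [MetricSpace X] [CompactSpace X] [NormedAddCommGroup E]
  [InnerProductSpace ℝ E] [FiniteDimensional ℝ E] {n : ℕ}

/-- A cutoff function and an approximate direction of motion near the starting points of long
bad pairs. -/
theorem exists_motion {f : C(X, E)} {F : C(X × X, E)} (hF : IsOddSep F) {ϑ ε : ℝ} (hϑ : 0 < ϑ)
    (hε : 0 < ε) (hu : ∀ x y z, IsBad f F x y → IsBad f F x z → f y ≠ f x → f z ≠ f x → y = z) :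
    ∃ (β : C(X, ℝ)) (δ : C(X, E)), (∀ x, 0 ≤ β x ∧ β x ≤ 1) ∧
      (∀ x y, IsBad f F x y → 2 * ϑ ≤ ‖f y - f x‖ → β x = 1 ∧ δ x = f y - f x) ∧
      (∀ x, β x ≠ 0 → ∃ x₀ y₀, IsBad f F x₀ y₀ ∧ 2 * ϑ ≤ ‖f y₀ - f x₀‖ ∧ dist x x₀ < ε ∧
        ‖f x - f x₀‖ < ε ∧ ‖δ x - (f y₀ - f x₀)‖ < ε) ∧
      (∀ x y, IsBad f F x y → ϑ ≤ ‖f y - f x‖ → (β x ≠ 0 ∨ β y ≠ 0) →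
        ∃ x₀ y₀, IsBad f F x₀ y₀ ∧ 2 * ϑ ≤ ‖f y₀ - f x₀‖ ∧ dist x x₀ < ε ∧
        ‖f x - f x₀‖ < ε ∧ ‖f y - f y₀‖ < ε ∧ ‖δ x - (f y₀ - f x₀)‖ < ε ∧
        ‖δ y - (f x₀ - f y₀)‖ < ε) := by
  let B : ℝ → Set (X × X) := fun τ => {z | IsBad f F z.1 z.2 ∧ τ ≤ ‖f z.2 - f z.1‖}
  have hB : ∀ τ, IsClosed (B τ) := fun τ => by
    have h1 : IsClosed {z : X × X | IsBad f F z.1 z.2} :=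
      isClosed_isBad continuous_const continuous_const continuous_fst continuous_snd
    have h2 : IsClosed {z : X × X | τ ≤ ‖f z.2 - f z.1‖} :=
      isClosed_le continuous_const (by fun_prop)
    exact h1.inter h2
  have hBsymm : ∀ τ x y, (x, y) ∈ B τ → (y, x) ∈ B τ := fun τ x y h =>
    ⟨h.1.symm hF, by rw [norm_sub_rev]; exact h.2⟩
  have hune : ∀ {τ : ℝ}, 0 < τ → ∀ {u v : E}, τ ≤ ‖u - v‖ → u ≠ v := by
    rintro τ hτ u v h rfl
    simp only [sub_self, norm_zero] at h
    linarith
  have : CompactSpace (B (2 * ϑ)) := isCompact_iff_compactSpace.1 (hB _).isCompact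
  obtain ⟨δ, hδ⟩ := ContinuousMap.exists_extension' (X₁ := B (2 * ϑ)) (X := X) (Y := E)
    (e := fun z => z.1.1)
    (Continuous.isClosedEmbedding (by fun_prop) (by
      rintro ⟨⟨x, y⟩, hy⟩ ⟨⟨x', z⟩, hz⟩ (h : x = x')
      subst h
      have := hu x y z hy.1 hz.1 (hune (by positivity) hy.2) (hune (by positivity) hz.2)
      subst this
      rfl))
    ⟨fun z => f z.1.2 - f z.1.1, by fun_prop⟩
  have hδ' : ∀ x y, (x, y) ∈ B (2 * ϑ) → δ x = f y - f x := fun x y h =>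
    congr_fun hδ ⟨(x, y), h⟩
  obtain ⟨η₁, hη₁, hη₁f⟩ := Metric.uniformContinuous_iff.1
    (CompactSpace.uniformContinuous_of_continuous f.continuous) ε hε
  obtain ⟨η₂, hη₂, hη₂δ⟩ := Metric.uniformContinuous_iff.1
    (CompactSpace.uniformContinuous_of_continuous δ.continuous) ε hε
  obtain ⟨η, hη, hηε, hη1, hη2⟩ : ∃ η > 0, η ≤ ε ∧ η ≤ η₁ ∧ η ≤ η₂ :=
    ⟨min ε (min η₁ η₂), by positivity, min_le_left _ _,
      (min_le_right _ _).trans (min_le_left _ _), (min_le_right _ _).trans (min_le_right _ _)⟩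
  have hηf : ∀ {x y}, dist x y < η → ‖f x - f y‖ < ε := fun h => by
    rw [← dist_eq_norm]; exact hη₁f (h.trans_le hη1)
  have hηδ : ∀ {x y}, dist x y < η → ‖δ x - δ y‖ < ε := fun h => by
    rw [← dist_eq_norm]; exact hη₂δ (h.trans_le hη2)
  have hclS : IsClosed (Prod.fst '' B (2 * ϑ)) := isClosedMap_fst_of_compactSpace _ (hB _)
  have hcl1 : IsClosed (⋂ z₀ ∈ B (2 * ϑ), {z : X × X | η ≤ dist z z₀}) :=
    isClosed_biInter fun z₀ _ => isClosed_le (by fun_prop) (by fun_prop)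
  have hcl2 : IsClosed (⋂ z₀ ∈ B (2 * ϑ), {x : X | η ≤ dist x z₀.1}) :=
    isClosed_biInter fun z₀ _ => isClosed_le (by fun_prop) (by fun_prop)
  obtain ⟨β, hβ0, hβ1, hβ⟩ := exists_continuous_zero_one_of_isClosed
    ((isClosedMap_fst_of_compactSpace _ ((hB ϑ).inter hcl1)).union hcl2) hclS (by
      rw [Set.disjoint_right]
      rintro _ ⟨⟨x, y⟩, hy, rfl⟩ (⟨⟨x', z⟩, ⟨hz, hz'⟩, h⟩ | h)
      · obtain rfl : x' = x := h
        have := hu x' y z hy.1 hz.1 (hune (by positivity) hy.2) (hune (by positivity) hz.2)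
        subst this
        have := Set.mem_iInter₂.1 hz' _ hy
        simp only [Set.mem_ofPred_eq, dist_self] at this
        linarith
      · have := Set.mem_iInter₂.1 h _ hy
        simp only [Set.mem_ofPred_eq, dist_self] at this
        linarith)
  have hQ : ∀ x y, (x, y) ∈ B ϑ → β x ≠ 0 → ∃ x₀ y₀, (x₀, y₀) ∈ B (2 * ϑ) ∧ dist x x₀ < η ∧
      dist y y₀ < η := by
    intro x y hxy hx
    by_contra! hcon
    refine hx (hβ0 (Or.inl ⟨(x, y), ⟨hxy, Set.mem_iInter₂.2 fun z₀ hz₀ => ?_⟩, rfl⟩))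
    by_contra! hlt
    simp only [Set.mem_ofPred_eq, not_le, Prod.dist_eq, max_lt_iff] at hlt
    exact (hcon z₀.1 z₀.2 hz₀ hlt.1).not_gt hlt.2
  refine ⟨β, δ, fun x => hβ x, fun x y h1 h2 => ⟨hβ1 ⟨(x, y), ⟨h1, h2⟩, rfl⟩,
    hδ' x y ⟨h1, h2⟩⟩, fun x hx => ?_, fun x y h1 h2 h3 => ?_⟩
  · by_contra! hcon
    refine hx (hβ0 (Or.inr (Set.mem_iInter₂.2 fun z₀ hz₀ => ?_)))
    by_contra! hlt
    simp only [Set.mem_ofPred_eq, not_le] at hlt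
    refine (hcon z₀.1 z₀.2 hz₀.1 hz₀.2 (hlt.trans_le hηε) (hηf hlt)).not_gt ?_
    rw [← hδ' z₀.1 z₀.2 hz₀]
    exact hηδ hlt
  · obtain ⟨x₀, y₀, hB₀, hx₀, hy₀⟩ : ∃ x₀ y₀, (x₀, y₀) ∈ B (2 * ϑ) ∧ dist x x₀ < η ∧
        dist y y₀ < η := by
      rcases h3 with h3 | h3
      · exact hQ x y ⟨h1, h2⟩ h3
      · obtain ⟨y₀, x₀, h, hy, hx⟩ := hQ y x (hBsymm _ _ _ ⟨h1, h2⟩) h3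
        exact ⟨x₀, y₀, hBsymm _ _ _ h, hx, hy⟩
    refine ⟨x₀, y₀, hB₀.1, hB₀.2, hx₀.trans_le hηε, hηf hx₀, hηf hy₀, ?_, ?_⟩
    · rw [← hδ' x₀ y₀ hB₀]
      exact hηδ hx₀
    · rw [← hδ' y₀ x₀ (hBsymm _ _ _ hB₀)]
      exact hηδ hy₀

end Step

section Step
variable {X E : Type} [MetricSpace X] [CompactSpace X] [NormedAddCommGroup E]
  [InnerProductSpace ℝ E] [FiniteDimensional ℝ E] {n : ℕ}

theorem TrackSep.exists_margin {f : C(X, E)} {F : C(X × X, E)} {τ r μ : ℝ}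
    (h : TrackSep f F τ r μ) :
    ∃ δ > 0, ∀ ε ≥ 0, ε < δ → TrackSep f F τ (r - 2 * ε) (μ + 4 * ε) := by
  have hopen : IsOpen {ε : ℝ | TrackSep f F τ (r - 2 * ε) (μ + 4 * ε)} :=
    (isOpen_trackSep τ).preimage (f := fun ε : ℝ => ((f, F), r - 2 * ε, μ + 4 * ε)) (by fun_prop)
  obtain ⟨δ, hδ, hball⟩ := Metric.isOpen_iff.1 hopen 0 (by simpa using h)
  exact ⟨δ, hδ, fun ε h0 h1 => hball (by simpa [abs_of_nonneg h0] using h1)⟩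

/-- One step shortening all long bad pairs. -/
theorem exists_shorten {f : C(X, E)} {F : C(X × X, E)} (hF : IsOddSep F) {ϑ ρ τ r μ : ℝ}
    (hϑ : 0 < ϑ) (hρ : 0 < ρ) (hρ' : 2 * ρ ≤ 1) (hτ : 0 < τ) (hρτ : 40 * (ρ * τ) ≤ ϑ)
    (hu : ∀ x y z, IsBad f F x y → IsBad f F x z → f y ≠ f x → f z ≠ f x → y = z)
    (hbad : ∀ x y, IsBad f F x y → ‖f y - f x‖ < τ) (hsep : TrackSep f F (2 * ϑ) r μ) :
    ∃ (f' : C(X, E)) (F' : C(X × X, E)), IsOddSep F' ∧ (∀ x, ‖f' x - f x‖ ≤ 2 * (ρ * τ)) ∧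
      (∀ x y, IsBad f' F' x y → ‖f' y - f' x‖ < max (3 * ϑ) ((1 - 2 * ρ) * τ)) ∧
      TrackSep f' F' (2 * ϑ) r μ := by
  obtain ⟨d, hd, hmargin⟩ := hsep.exists_margin
  obtain ⟨ε, hε, hεd, hετ⟩ : ∃ ε > 0, ε < d ∧ ε ≤ τ :=
    ⟨min (d / 2) τ, by positivity, (min_le_left _ _).trans_lt (by linarith), min_le_right _ _⟩
  obtain ⟨β, δ, hβ, hQ1, hQ2, hQ3⟩ := exists_motion hF hϑ hε hu
  let h : C(X, E) := ⟨fun x => (ρ * β x) • δ x, by fun_prop⟩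
  have hh : ∀ x, ‖h x‖ ≤ 2 * (ρ * τ) := by
    intro x
    by_cases hx : β x = 0
    · simp only [h, ContinuousMap.coe_mk, hx, mul_zero, zero_smul, norm_zero]
      positivity
    · obtain ⟨x₀, y₀, hb, -, -, -, hδ⟩ := hQ2 x hx
      have h1 := hbad _ _ hb
      have h2 : ‖δ x‖ ≤ 2 * τ := by
        have := norm_le_norm_add_norm_sub' (δ x) (f y₀ - f x₀)
        linarith
      simp only [h, ContinuousMap.coe_mk]
      rw [norm_smul, Real.norm_of_nonneg (mul_nonneg hρ.le (hβ x).1)]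
      calc ρ * β x * ‖δ x‖ ≤ ρ * 1 * (2 * τ) := by
            gcongr
            exact (hβ x).2
        _ = _ := by ring
  let c : C(X × X, E) := diffMap h
  have hc : ∀ z, ‖c z‖ ≤ ϑ / 10 := fun z => by
    have h1 := norm_sub_le (h z.1) (h z.2)
    have h2 := hh z.1
    have h3 := hh z.2
    simp only [c, diffMap_apply]
    linarith
  let a : C(X × X, E) := diffMap f
  let g : C(ℝ, ℝ) := ⟨fun u => ramp (ϑ / 2) ϑ u * ((max u (ϑ / 2)) ^ 2)⁻¹, by
    refine (ContinuousMap.continuous _).mul (Continuous.inv₀ (by fun_prop) fun u => ?_)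
    have : 0 < max u (ϑ / 2) := lt_max_of_lt_right (by positivity)
    positivity⟩
  have hg : ∀ u, ϑ ≤ u → g u = (u ^ 2)⁻¹ := fun u hu => by
    simp [g, ramp_of_ge (show ϑ / 2 < ϑ by linarith) hu, max_eq_left (show ϑ / 2 ≤ u by linarith)]
  have hg' : ∀ u, 0 ≤ u → |g u| * u ≤ 2 / ϑ := fun u hu => by
    have hm : 0 < max u (ϑ / 2) := lt_max_of_lt_right (by positivity)
    simp only [g, ContinuousMap.coe_mk]
    rw [abs_of_nonneg (mul_nonneg (ramp_nonneg _ _ _) (by positivity))]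
    calc _ ≤ 1 * ((max u (ϑ / 2)) ^ 2)⁻¹ * max u (ϑ / 2) := by
          gcongr
          · exact ramp_le_one _ _ _
          · exact le_max_left _ _
      _ = (max u (ϑ / 2))⁻¹ := by field_simp
      _ ≤ (ϑ / 2)⁻¹ := by gcongr; exact le_max_right _ _
      _ = 2 / ϑ := by field_simp
  let f' : C(X, E) := f + h
  have hf' : ∀ x, f' x = f x + h x := fun x => rfl
  let F' : C(X × X, E) := ⟨fun z => F z + (g ‖a z‖ * inner ℝ (a z) (F z)) • c z, by fun_prop⟩
  have hF' : ∀ z, F' z = F z + (g ‖a z‖ * inner ℝ (a z) (F z)) • c z := fun z => rfl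
  have ha' : ∀ x y, f' y - f' x = (f y - f x) - c (x, y) := fun x y => by
    simp only [hf', c, diffMap_apply]; abel
  have haf : ∀ x y, ‖a (x, y)‖ = ‖f y - f x‖ := fun x y => by
    simp only [a, diffMap_apply]; exact norm_sub_rev _ _
  have hlen : ∀ x y, |‖f' y - f' x‖ - ‖f y - f x‖| ≤ ϑ / 10 := fun x y => by
    refine (abs_norm_sub_norm_le _ _).trans ?_
    rw [ha', sub_sub_cancel_left, norm_neg]
    exact hc _
  have hshear : ∀ x y, ϑ ≤ ‖f y - f x‖ → (IsBad f' F' x y ↔ IsBad f F x y) := by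
    intro x y hxy
    have h1 : f' y - f' x = (f y - f x) +
        ((‖a (x, y)‖ ^ 2)⁻¹ * inner ℝ (a (x, y)) (f y - f x)) • c (x, y) := by
      have h2 : f y - f x = - a (x, y) := by simp [a]
      have h3 : 0 < ‖a (x, y)‖ := by rw [haf]; linarith
      rw [ha', h2, inner_neg_right, real_inner_self_eq_norm_sq]
      field_simp
      module
    unfold IsBad
    rw [h1, hF', hg _ (by rwa [haf])]
    refine sameRay_shear_iff ((hc _).trans_lt ?_) _ _
    rw [haf]
    linarith
  have hbad' : ∀ x y, IsBad f' F' x y → 2 * ϑ ≤ ‖f' y - f' x‖ →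
      IsBad f F x y ∧ ϑ ≤ ‖f y - f x‖ := fun x y h1 h2 => by
    have h3 := (abs_le.1 (hlen x y)).2
    have h4 : ϑ ≤ ‖f y - f x‖ := by linarith
    exact ⟨(hshear x y h4).1 h1, h4⟩
  have htrack : ∀ x y, ∀ s : I, IsTrack f' F' (2 * ϑ) x y → ∃ x₀ y₀, ∃ s₀ : I,
      IsTrack f F (2 * ϑ) x₀ y₀ ∧ dist x x₀ ≤ ε ∧
      ‖(f' x + (s : ℝ) • (f' y - f' x)) - (f x₀ + (s₀ : ℝ) • (f y₀ - f x₀))‖ ≤ 2 * ε := by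
    have hρβ : ∀ x, 0 ≤ ρ * β x ∧ ρ * β x ≤ 1 := fun x =>
      ⟨mul_nonneg hρ.le (hβ x).1, by nlinarith [(hβ x).1, (hβ x).2]⟩
    have hest : ∀ {p q : E} {u : ℝ}, ‖p‖ < ε → ‖q‖ < ε → 0 ≤ u → u ≤ 1 → ‖p + u • q‖ ≤ 2 * ε := by
      intro p q u hp hq h0 h1
      have h2 := norm_add_le p (u • q)
      rw [norm_smul, Real.norm_of_nonneg h0] at h2
      nlinarith [norm_nonneg q]
    have hh0 : ∀ x, β x = 0 → f' x = f x := fun x hx => by simp [hf', h, hx]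
    rintro x y s (rfl | ⟨h1, h2⟩)
    · simp only [sub_self, smul_zero, add_zero]
      by_cases hx : β x = 0
      · refine ⟨x, x, 0, Or.inl rfl, by simp [hε.le], ?_⟩
        simp [hh0 x hx, hε.le]
      · obtain ⟨x₀, y₀, hb, hl, hdist, hfx, hδx⟩ := hQ2 x hx
        refine ⟨x₀, y₀, ⟨ρ * β x, hρβ x⟩, Or.inr ⟨hb, hl⟩, hdist.le, ?_⟩
        have : f' x - (f x₀ + (ρ * β x) • (f y₀ - f x₀)) =
            (f x - f x₀) + (ρ * β x) • (δ x - (f y₀ - f x₀)) := by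
          simp only [hf', h, ContinuousMap.coe_mk]; module
        rw [this]
        exact hest hfx hδx (hρβ x).1 (hρβ x).2
    · obtain ⟨h3, h4⟩ := hbad' x y h1 h2
      by_cases hxy : β x ≠ 0 ∨ β y ≠ 0
      · obtain ⟨x₀, y₀, hb, hl, hdist, hfx, hfy, hδx, hδy⟩ := hQ3 x y h3 h4 hxy
        have hs := s.2
        have hs1 : 0 ≤ 1 - (s : ℝ) := by linarith [hs.2]
        have hx1 := hρβ x
        have hy1 := hρβ y
        refine ⟨x₀, y₀, ⟨(1 - s) * (ρ * β x) + s * (1 - ρ * β y), ?_, ?_⟩,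
          Or.inr ⟨hb, hl⟩, hdist.le, ?_⟩
        · nlinarith [mul_nonneg hs1 hx1.1, mul_nonneg hs.1 (sub_nonneg.2 hy1.2)]
        · nlinarith [mul_nonneg hs1 (sub_nonneg.2 hx1.2), mul_nonneg hs.1 hy1.1]
        · have : f' x + (s : ℝ) • (f' y - f' x) -
              (f x₀ + ((1 - (s : ℝ)) * (ρ * β x) + s * (1 - ρ * β y)) • (f y₀ - f x₀)) =
              (1 - (s : ℝ)) • ((f x - f x₀) + (ρ * β x) • (δ x - (f y₀ - f x₀))) +
              (s : ℝ) • ((f y - f y₀) + (ρ * β y) • (δ y - (f x₀ - f y₀))) := by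
            simp only [hf', h, ContinuousMap.coe_mk]; module
          simp only [this]
          refine (norm_add_le _ _).trans ?_
          rw [norm_smul, norm_smul, Real.norm_of_nonneg hs1, Real.norm_of_nonneg hs.1]
          have h5 := hest hfx hδx hx1.1 hx1.2
          have h6 := hest hfy hδy hy1.1 hy1.2
          nlinarith [mul_le_mul_of_nonneg_left h5 hs1, mul_le_mul_of_nonneg_left h6 hs.1]
      · push Not at hxy
        rw [hh0 x hxy.1, hh0 y hxy.2] at h2 ⊢
        exact ⟨x, y, s, Or.inr ⟨h3, h2⟩, by simp [hε.le], by simp [hε.le]⟩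
  refine ⟨f', F', ⟨fun x y => ?_, fun x y h0 => hF.2 x y ?_⟩, fun x => ?_, fun x y hb => ?_,
    fun x y z w s t hxy hzw hxz => ?_⟩
  · have h1 : a (y, x) = - a (x, y) := diffMap_odd f x y
    have h2 : c (y, x) = - c (x, y) := diffMap_odd h x y
    rw [hF', hF', h1, h2, hF.1 x y, norm_neg, inner_neg_neg, smul_neg, neg_add]
  · rw [hF', add_eq_zero_iff_eq_neg] at h0
    have h1 : ‖F (x, y)‖ ≤ 1 / 2 * ‖F (x, y)‖ := by
      calc ‖F (x, y)‖ = ‖(g ‖a (x, y)‖ * inner ℝ (a (x, y)) (F (x, y))) • c (x, y)‖ := by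
            conv_lhs => rw [h0, norm_neg]
        _ = |g ‖a (x, y)‖| * |inner ℝ (a (x, y)) (F (x, y))| * ‖c (x, y)‖ := by
          rw [norm_smul, norm_mul, Real.norm_eq_abs, Real.norm_eq_abs]
        _ ≤ |g ‖a (x, y)‖| * (‖a (x, y)‖ * ‖F (x, y)‖) * (ϑ / 10) := by
          gcongr
          · exact abs_real_inner_le_norm _ _
          · exact hc _
        _ = (|g ‖a (x, y)‖| * ‖a (x, y)‖) * (‖F (x, y)‖ * (ϑ / 10)) := by ring
        _ ≤ 2 / ϑ * (‖F (x, y)‖ * (ϑ / 10)) := by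
          gcongr
          exact hg' _ (norm_nonneg _)
        _ = 1 / 5 * ‖F (x, y)‖ := by field_simp; ring
        _ ≤ 1 / 2 * ‖F (x, y)‖ := by gcongr; norm_num
    exact norm_eq_zero.1 (le_antisymm (by linarith) (norm_nonneg _))
  · rw [hf', add_sub_cancel_left]
    exact hh x
  · by_cases h2 : 2 * ϑ ≤ ‖f y - f x‖
    · have h3 := (hshear x y (by linarith)).1 hb
      obtain ⟨hx1, hx2⟩ := hQ1 x y h3 h2
      obtain ⟨hy1, hy2⟩ := hQ1 y x (h3.symm hF) (by rwa [norm_sub_rev])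
      have h4 : f' y - f' x = (1 - 2 * ρ) • (f y - f x) := by
        simp only [hf', h, ContinuousMap.coe_mk, hx1, hx2, hy1, hy2]; module
      refine lt_max_of_lt_right ?_
      have h5 := hbad x y h3
      rw [h4, norm_smul, Real.norm_of_nonneg (by linarith)]
      rcases hρ'.lt_or_eq with hlt | heq
      · exact mul_lt_mul_of_pos_left h5 (by linarith)
      · have : ‖f y - f x‖ < ϑ := by nlinarith
        linarith
    · have h3 := (abs_le.1 (hlen x y)).2
      exact lt_max_of_lt_left (by linarith)
  · obtain ⟨x₀, y₀, s₀, hT, hx₀, hp⟩ := htrack x y s hxy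
    obtain ⟨z₀, w₀, t₀, hT', hz₀, hq⟩ := htrack z w t hzw
    have h1 := hmargin ε hε.le hεd x₀ y₀ z₀ w₀ s₀ t₀ hT hT' (by
      have h2 := dist_triangle4 x x₀ z₀ z
      rw [dist_comm z₀ z] at h2
      linarith)
    set p := f' x + (s : ℝ) • (f' y - f' x)
    set q := f' z + (t : ℝ) • (f' w - f' z)
    set p₀ := f x₀ + (s₀ : ℝ) • (f y₀ - f x₀)
    set q₀ := f z₀ + (t₀ : ℝ) • (f w₀ - f z₀)
    have h2 : ‖p₀ - q₀‖ ≤ ‖p - q‖ + (‖p - p₀‖ + ‖q - q₀‖) := by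
      have h3 : p₀ - q₀ = (p - q) - ((p - p₀) - (q - q₀)) := by abel
      rw [h3]
      exact (norm_sub_le _ _).trans (by gcongr; exact norm_sub_le _ _)
    linarith

end Step

section Phase
variable {X E : Type} [MetricSpace X] [CompactSpace X] [NormedAddCommGroup E]
  [InnerProductSpace ℝ E] [FiniteDimensional ℝ E] {n : ℕ}

/-- Shorten all bad pairs below a prescribed size while keeping distant points apart. -/
theorem exists_bad_small (hX : DimProp X n) (h1 : 3 * n + 2 < 2 * Module.finrank ℝ E)
    (h2 : 4 * n + 4 < 3 * Module.finrank ℝ E) {f : C(X, E)} {F : C(X × X, E)} (hF : IsOddSep F)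
    {ϑ τ r μ : ℝ} (hϑ : 0 < ϑ) (hϑτ : ϑ ≤ τ)
    (hbad : ∀ x y, IsBad f F x y → ‖f y - f x‖ < τ) (hsep : TrackSep f F (2 * ϑ) r μ) :
    ∃ (f' : C(X, E)) (F' : C(X × X, E)), IsOddSep F' ∧ (∀ x, ‖f' x - f x‖ ≤ 2 * τ) ∧
      (∀ x y, IsBad f' F' x y → ‖f' y - f' x‖ < 3 * ϑ) ∧ TrackSep f' F' (2 * ϑ) r μ := by
  have hτ : 0 < τ := hϑ.trans_le hϑτ
  obtain ⟨ρ, hρ, hρτ⟩ : ∃ ρ > 0, 40 * (ρ * τ) = ϑ := ⟨ϑ / (40 * τ), by positivity, by field_simp⟩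
  have hρ' : 4 * ρ < 1 := by nlinarith
  have key : ∀ k : ℕ, ∃ (f' : C(X, E)) (F' : C(X × X, E)), IsOddSep F' ∧
      (∀ x, ‖f' x - f x‖ ≤ 2 * τ * (1 - (1 - 2 * ρ) ^ k)) ∧
      (∀ x y, IsBad f' F' x y → ‖f' y - f' x‖ < max (3 * ϑ) ((1 - 2 * ρ) ^ k * τ)) ∧
      TrackSep f' F' (2 * ϑ) r μ := by
    intro k
    induction k with
    | zero => exact ⟨f, F, hF, by simp, fun x y h => lt_max_of_lt_right (by simpa using hbad x y h),
        hsep⟩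
    | succ k ih =>
      obtain ⟨f₁, F₁, hF₁, hf₁, hbad₁, hsep₁⟩ := ih
      set t := (1 - 2 * ρ) ^ k with ht
      have ht0 : 0 < t := pow_pos (by linarith) k
      have ht1 : t ≤ 1 := pow_le_one₀ (by linarith) (by linarith)
      rcases le_total (t * τ) (3 * ϑ) with hle | hle
      · refine ⟨f₁, F₁, hF₁, fun x => (hf₁ x).trans ?_, fun x y h => ?_, hsep₁⟩
        · rw [pow_succ, ← ht]
          nlinarith [mul_pos (mul_pos hτ hρ) ht0]
        · exact lt_max_of_lt_left ((hbad₁ x y h).trans_eq (max_eq_left hle))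
      · rw [max_eq_right hle] at hbad₁
        have ht2 : 0 < t * τ := by positivity
        obtain ⟨f₂, F₂, hF₂, ⟨hbad₂, hsep₂⟩, hf₂, hgen⟩ := exists_rayGeneric hX h1 h2 hF₁
          (U := {p | ∀ x y, IsBad p.1 p.2 x y → ‖p.1 y - p.1 x‖ < t * τ} ∩
            {p | TrackSep p.1 p.2 (2 * ϑ) r μ})
          ((isOpen_bad_lt _).inter ((isOpen_trackSep (2 * ϑ)).preimage
            (f := fun p : C(X, E) × C(X × X, E) => (p, r, μ)) (by fun_prop)))
          ⟨hbad₁, hsep₁⟩ (ε := 2 * (ρ * (t * τ))) (by positivity)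
        obtain ⟨f₃, F₃, hF₃, hf₃, hbad₃, hsep₃⟩ := exists_shorten hF₂ hϑ hρ (by linarith) ht2
          (by rw [← hρτ]; nlinarith [mul_pos hρ hτ]) (by
            intro x y z hy hz hxy hxz
            by_contra hyz
            obtain ⟨a, ha⟩ := hy.exists_eq_smul hxy
            obtain ⟨b, hb⟩ := hz.exists_eq_smul hxz
            exact hgen.two_rays x y z (fun h => hxy (by rw [h])) (fun h => hxz (by rw [h]))
              hyz a b ha hb) hbad₂ hsep₂
        refine ⟨f₃, F₃, hF₃, fun x => ?_, fun x y h => (hbad₃ x y h).trans_eq ?_, hsep₃⟩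
        · have e1 := hf₁ x
          have e2 := hf₂ x
          have e3 := hf₃ x
          have e4 : f₃ x - f x = (f₃ x - f₂ x) + ((f₂ x - f₁ x) + (f₁ x - f x)) := by abel
          have e5 := norm_add_le (f₃ x - f₂ x) ((f₂ x - f₁ x) + (f₁ x - f x))
          have e6 := norm_add_le (f₂ x - f₁ x) (f₁ x - f x)
          rw [e4, pow_succ, ← ht]
          linarith
        · rw [pow_succ, ← ht]
          ring_nf
  obtain ⟨k, hk⟩ := exists_pow_lt_of_lt_one (show 0 < 3 * ϑ / τ by positivity)
    (show 1 - 2 * ρ < 1 by linarith)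
  obtain ⟨f', F', hF', hf', hbad', hsep'⟩ := key k
  refine ⟨f', F', hF', fun x => (hf' x).trans ?_, fun x y h => (hbad' x y h).trans_eq
    (max_eq_left ?_), hsep'⟩
  · have : 0 < (1 - 2 * ρ) ^ k := pow_pos (by linarith) k
    nlinarith
  · exact ((lt_div_iff₀ hτ).1 hk).le

/-- If all bad pairs are short, then `F` can be replaced by a function close to the difference
function. -/
theorem exists_close_of_bad_small {f : C(X, E)} {F : C(X × X, E)} (hF : IsOddSep F) {τ : ℝ}
    (hτ : 0 < τ) (hbad : ∀ x y, IsBad f F x y → ‖f y - f x‖ < τ) :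
    ∃ F' : C(X × X, E), IsOddSep F' ∧ ∀ z, ‖F' z - diffMap f z‖ ≤ 3 * τ := by
  obtain ⟨κ, hκ, hκF⟩ : ∃ κ > 0, ∀ z, κ * ‖F z‖ ≤ τ := by
    refine ⟨τ / (‖F‖ + 1), by positivity, fun z => ?_⟩
    calc τ / (‖F‖ + 1) * ‖F z‖ ≤ τ / (‖F‖ + 1) * (‖F‖ + 1) := by
          gcongr
          linarith [F.norm_coe_le_norm z]
      _ = τ := by field_simp
  let a : C(X × X, E) := diffMap f
  let χ : C(X × X, ℝ) := ⟨fun z => ramp τ (2 * τ) ‖a z‖, by fun_prop⟩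
  have hχ : ∀ z, 0 ≤ χ z ∧ χ z ≤ 1 := fun z => ⟨ramp_nonneg _ _ _, ramp_le_one _ _ _⟩
  have h2τ : τ < 2 * τ := by linarith
  let F' : C(X × X, E) := ⟨fun z => ((1 - χ z) * κ) • F z + χ z • a z, by fun_prop⟩
  have hF' : ∀ z, F' z = ((1 - χ z) * κ) • F z + χ z • a z := fun z => rfl
  refine ⟨F', ⟨fun x y => ?_, fun x y h0 => ?_⟩, fun z => ?_⟩
  · have h1 : a (y, x) = - a (x, y) := diffMap_odd f x y
    have h2 : χ (y, x) = χ (x, y) := by simp [χ, h1]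
    rw [hF', hF', h1, h2, hF.1 x y, smul_neg, smul_neg, neg_add]
  · rw [hF'] at h0
    rcases le_or_gt ‖a (x, y)‖ τ with hle | hlt
    · have h1 : χ (x, y) = 0 := ramp_of_le h2τ hle
      rw [h1, sub_zero, one_mul, zero_smul, add_zero, smul_eq_zero] at h0
      exact hF.2 x y (h0.resolve_left hκ.ne')
    · exfalso
      have hane : a (x, y) ≠ 0 := fun h => by rw [h, norm_zero] at hlt; linarith
      have h2 := hχ (x, y)
      rcases h2.2.lt_or_eq with h1 | h1
      · have h3 : 0 < (1 - χ (x, y)) * κ := mul_pos (by linarith) hκ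
        have h4 : SameRay ℝ (((1 - χ (x, y)) * κ) • F (x, y)) (χ (x, y) • (f y - f x)) := by
          have h5 : χ (x, y) • (f y - f x) = - (χ (x, y) • a (x, y)) := by
            rw [← smul_neg]; simp [a]
          rw [h5, eq_neg_of_add_eq_zero_left h0]
        rcases h2.1.lt_or_eq with h5 | h5
        · have h6 : IsBad f F x y := by
            have := (h4.pos_smul_left (inv_pos.2 h3)).pos_smul_right (inv_pos.2 h5)
            rwa [smul_smul, smul_smul, inv_mul_cancel₀ h3.ne', inv_mul_cancel₀ h5.ne', one_smul,
              one_smul] at this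
          have h7 := hbad x y h6
          rw [norm_sub_rev] at h7
          exact lt_asymm hlt h7
        · rw [← h5, sub_zero, one_mul, zero_smul, add_zero, smul_eq_zero] at h0
          have := hF.2 x y (h0.resolve_left hκ.ne')
          exact hane (by simp [a, this])
      · rw [h1, sub_self, zero_mul, zero_smul, zero_add, one_smul] at h0
        exact hane h0
  · rcases le_or_gt (2 * τ) ‖a z‖ with hle | hlt
    · have h1 : χ z = 1 := ramp_of_ge h2τ hle
      rw [hF', h1, sub_self, zero_mul, zero_smul, zero_add, one_smul]
      simp only [a, sub_self, norm_zero]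
      positivity
    · have h1 : F' z - diffMap f z = (1 - χ z) • (κ • F z - a z) := by
        rw [hF']; simp only [a]; module
      have h2 := hχ z
      rw [h1, norm_smul, Real.norm_of_nonneg (by linarith)]
      have h3 := norm_sub_le (κ • F z) (a z)
      rw [norm_smul, Real.norm_of_nonneg hκ.le] at h3
      have h4 := hκF z
      nlinarith [norm_nonneg (κ • F z - a z)]
end Phase

section Embed
variable {X : Type} [MetricSpace X] [CompactSpace X] {n m : ℕ}

theorem exists_round (hX : DimProp X n) (hm : 2 * m > 3 * (n + 1))
    {f : C(X, EuclideanSpace ℝ (Fin m))} {F : C(X × X, EuclideanSpace ℝ (Fin m))}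
    (hF : IsOddSep F) {s r κ : ℝ} (hs : 0 < s) (hr : 0 < r) (hκ : 0 < κ)
    (hclose : ∀ z, ‖F z - diffMap f z‖ ≤ s) :
    ∃ (f' : C(X, EuclideanSpace ℝ (Fin m))) (F' : C(X × X, EuclideanSpace ℝ (Fin m)))
      (s' μ : ℝ), IsOddSep F' ∧ (∀ x, ‖f' x - f x‖ ≤ (3 * (m * 4 ^ m) + 3) * s) ∧ 0 < s' ∧
      s' ≤ κ * s ∧ s' ≤ κ * μ ∧ (∀ z, ‖F' z - diffMap f' z‖ ≤ s') ∧
      ∀ x y, r ≤ dist x y → μ < ‖f' x - f' y‖ := by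
  obtain ⟨f₁, F₁, hF₁, hclose₁, hf₁, hex⟩ := exists_exact_of_close hX (by omega) hF hs hr hclose
  set K : ℝ := m * 4 ^ m with hK
  have hKs : (m : ℝ) * (4 ^ m * s) = K * s := by rw [hK]; ring
  have hK0 : 0 ≤ K := by positivity
  rw [hKs] at hclose₁ hf₁
  obtain ⟨f₂, F₂, hF₂, hf₂, hbad₂, μ, hμ, hsep₂⟩ := exists_trackSep hX
    (by rw [finrank_euclideanSpace_fin]; omega) (by rw [finrank_euclideanSpace_fin]; omega)
    hF₁ (r := r) (τ := K * s + s) (ε := s) hr hs (by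
      intro x y hxy hb
      have h0 : F₁ (x, y) = 0 := by
        have h1 := hex x y hxy
        have h2 := isBad_iff.1 hb
        rw [h1, diffMap_apply] at h2
        have h3 : f₁ x - f₁ y + (f₁ y - f₁ x) = 0 := by abel
        rw [h3, norm_zero] at h2
        rw [h1, diffMap_apply]
        exact norm_eq_zero.1 (le_antisymm
          (by linarith [norm_nonneg (f₁ y - f₁ x)]) (norm_nonneg _))
      have := hF₁.2 x y h0
      rw [this, dist_self] at hxy
      linarith) (fun x y hb => by
      have := IsBad.norm_le (hclose₁ (x, y)) hb
      linarith)
  obtain ⟨ϑ, hϑ, hϑ1, hϑ2, hϑ3⟩ : ∃ ϑ > 0, ϑ ≤ K * s + s ∧ 9 * ϑ ≤ κ * s ∧ 9 * ϑ ≤ κ * μ := by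
    refine ⟨min (K * s + s) (min (κ * s / 9) (κ * μ / 9)), by positivity, min_le_left _ _, ?_, ?_⟩
    · linarith [(min_le_right (K * s + s) (min (κ * s / 9) (κ * μ / 9))).trans (min_le_left _ _)]
    · linarith [(min_le_right (K * s + s) (min (κ * s / 9) (κ * μ / 9))).trans (min_le_right _ _)]
  obtain ⟨f₃, F₃, hF₃, hf₃, hbad₃, hsep₃⟩ := exists_bad_small hX
    (by rw [finrank_euclideanSpace_fin]; omega) (by rw [finrank_euclideanSpace_fin]; omega)
    hF₂ hϑ hϑ1 hbad₂ (hsep₂.mono (by positivity))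
  obtain ⟨F₄, hF₄, hclose₄⟩ := exists_close_of_bad_small hF₃ (by positivity) hbad₃
  refine ⟨f₃, F₄, 9 * ϑ, μ, hF₄, fun x => ?_, by positivity, hϑ2, hϑ3,
    fun z => (hclose₄ z).trans_eq (by ring), fun x y hxy => ?_⟩
  · have e1 := hf₁ x
    have e2 := hf₂ x
    have e3 := hf₃ x
    have e4 : f₃ x - f x = (f₃ x - f₂ x) + ((f₂ x - f₁ x) + (f₁ x - f x)) := by abel
    have e5 := norm_add_le (f₃ x - f₂ x) ((f₂ x - f₁ x) + (f₁ x - f x))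
    have e6 := norm_add_le (f₂ x - f₁ x) (f₁ x - f x)
    rw [e4]
    linarith
  · simpa using hsep₃ x x y y 0 0 (Or.inl rfl) (Or.inl rfl) hxy

/-- In the metastable range, an odd separating function on the square yields an embedding. -/
theorem exists_injective_of_isOddSep (hX : DimProp X n) (hm : 2 * m > 3 * (n + 1))
    {F : C(X × X, EuclideanSpace ℝ (Fin m))} (hF : IsOddSep F) :
    ∃ f : C(X, EuclideanSpace ℝ (Fin m)), Function.Injective f := by
  set K : ℝ := 3 * (m * 4 ^ m) + 3 with hK
  have hK0 : 0 < K := by positivity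
  let κ : ℝ := 1 / (8 * K)
  have hκ : 0 < κ := by positivity
  have hκK : 4 * K * κ = 1 / 2 := by simp only [κ]; field_simp; norm_num
  have hκ2 : κ ≤ 1 / 2 := by
    have : 3 ≤ K := by rw [hK]; linarith [show (0 : ℝ) ≤ 3 * (m * 4 ^ m) by positivity]
    nlinarith
  let S := {p : C(X, EuclideanSpace ℝ (Fin m)) × C(X × X, EuclideanSpace ℝ (Fin m)) × ℝ //
    IsOddSep p.2.1 ∧ 0 < p.2.2 ∧ ∀ z, ‖p.2.1 z - diffMap p.1 z‖ ≤ p.2.2}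
  have hround : ∀ (j : ℕ) (p : S), ∃ q : S, dist p.1.1 q.1.1 ≤ K * p.1.2.2 ∧
      q.1.2.2 ≤ p.1.2.2 / 2 ∧ ∀ x y, (1 : ℝ) / (j + 1) ≤ dist x y →
        4 * K * q.1.2.2 < ‖q.1.1 x - q.1.1 y‖ := by
    rintro j ⟨⟨f, F, s⟩, hF, hs, hclose⟩
    obtain ⟨f', F', s', μ, hF', hf', hs', hs1, hs2, hclose', hsep⟩ := exists_round hX hm hF hs
      (r := 1 / (j + 1)) (by positivity) hκ hclose
    refine ⟨⟨⟨f', F', s'⟩, hF', hs', hclose'⟩, ?_, ?_, fun x y hxy => ?_⟩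
    · rw [dist_comm]
      refine (ContinuousMap.dist_le (by positivity)).2 fun x => ?_
      rw [dist_eq_norm]
      exact hf' x
    · simp only at hs ⊢
      nlinarith
    · have h1 := hsep x y hxy
      simp only
      have h2 : 4 * K * s' ≤ 4 * K * κ * μ := by
        rw [mul_assoc (4 * K)]
        gcongr
      rw [hκK] at h2
      have h3 : 0 < μ := by
        have : 0 < κ * μ := hs'.trans_le hs2
        exact pos_of_mul_pos_right this hκ.le
      linarith
  choose next hnext1 hnext2 hnext3 using hround
  let p : ℕ → S := fun j => Nat.rec ⟨⟨0, F, ‖F‖ + 1⟩, hF, by positivity, fun z => by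
    have := F.norm_coe_le_norm z
    simp only [diffMap_apply, ContinuousMap.zero_apply, sub_self, sub_zero]
    linarith⟩ (fun j q => next j q) j
  have hp : ∀ j, p (j + 1) = next j (p j) := fun j => rfl
  have hhalf : ∀ i j, (p (i + j)).1.2.2 ≤ (p i).1.2.2 / 2 ^ j := by
    intro i j
    induction j with
    | zero => simp
    | succ j ih =>
      rw [← add_assoc, hp, pow_succ, ← div_div]
      exact (hnext2 _ _).trans (by gcongr)
  have hstep : ∀ i j, dist (p (i + j)).1.1 (p (i + (j + 1))).1.1 ≤
      2 * K * (p i).1.2.2 / 2 / 2 ^ j := by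
    intro i j
    rw [← add_assoc, hp]
    refine (hnext1 _ _).trans ?_
    calc K * (p (i + j)).1.2.2 ≤ K * ((p i).1.2.2 / 2 ^ j) := by gcongr; exact hhalf i j
      _ = _ := by ring
  obtain ⟨f, hf⟩ := cauchySeq_tendsto_of_complete
    (cauchySeq_of_le_geometric_two (f := fun j => (p j).1.1) (C := 2 * K * (p 0).1.2.2)
      (fun j => by simpa using hstep 0 j))
  have hlim : ∀ i, dist (p i).1.1 f ≤ 2 * K * (p i).1.2.2 := by
    intro i
    refine dist_le_of_le_geometric_two_of_tendsto₀ (f := fun j => (p (i + j)).1.1) (hstep i) ?_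
    simpa only [add_comm i] using (Filter.tendsto_add_atTop_iff_nat i).2 hf
  refine ⟨f, fun x y hxy => ?_⟩
  by_contra hne
  obtain ⟨j, hj⟩ := exists_nat_one_div_lt (dist_pos.2 hne)
  have h1 := hnext3 j (p j) x y hj.le
  rw [← hp] at h1
  have h2 := hlim (j + 1)
  have h3 := (ContinuousMap.dist_apply_le_dist x).trans h2
  have h4 := (ContinuousMap.dist_apply_le_dist y).trans h2
  rw [hxy] at h3
  rw [← dist_eq_norm] at h1
  have h5 := dist_triangle_right ((p (j + 1)).1.1 x) ((p (j + 1)).1.1 y) (f y)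
  linarith

end Embed

section PathPert
variable {Y E : Type} [TopologicalSpace Y] [CompactSpace Y] [T2Space Y]
  [NormedAddCommGroup E] [NormedSpace ℝ E] [FiniteDimensional ℝ E] {d : ℕ}

/-- The involution `(y, y', s) ↦ (y', y, 1 - s)`. -/
def pathTwist {Y : Type} (z : (Y × Y) × I) : (Y × Y) × I := (z.1.swap, σ z.2)

theorem continuous_pathTwist {Y : Type} [TopologicalSpace Y] :
    Continuous (pathTwist (Y := Y)) := by
  unfold pathTwist
  exact (continuous_swap.comp continuous_fst).prodMk
    (unitInterval.continuous_symm.comp continuous_snd)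

/-- Perturbation of a family of paths, equivariant with respect to `pathTwist`. -/
def pathPert {Y E : Type} [NormedAddCommGroup E] [NormedSpace ℝ E] (φ₀ : (Y × Y) × I → E)
    (w : (Y × Y) × I → ℝ) (P : (Y × Y) × I → E) (z : (Y × Y) × I) : E :=
  φ₀ z + w z • (P z - P (pathTwist z))

theorem continuous_pathPert {A : Type*} [TopologicalSpace A] {φ₀ : C((Y × Y) × I, E)}
    {w : C((Y × Y) × I, ℝ)} {P : A → C((Y × Y) × I, E)} {z : A → (Y × Y) × I}
    (hP : Continuous P) (hz : Continuous z) :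
    Continuous fun a => pathPert φ₀ w (P a) (z a) := by
  unfold pathPert
  have : Continuous fun a => pathTwist (z a) := continuous_pathTwist.comp hz
  fun_prop

theorem dense_pathPert_box (hY : DimProp Y d) (φ₀ : C((Y × Y) × I, E)) (w : C((Y × Y) × I, ℝ))
    (hd : d + 1 < Module.finrank ℝ E) {B₀ B₁ : Set Y} (hB₀ : IsClosed B₀) (hB₁ : IsClosed B₁)
    (hB : Disjoint B₀ B₁) {J₀ J₁ : Set I} (hJ₀ : IsClosed J₀) (hJ₁ : IsClosed J₁)
    (hJ : Disjoint J₀ J₁) {c : ℝ} (hc : 0 < c) :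
    Dense {P : C((Y × Y) × I, E) | ∀ y ∈ B₀, ∀ y' ∈ B₁, ∀ s ∈ J₀, ∀ s' ∈ J₁,
      c ≤ w ((y, y'), s) → c ≤ w ((y, y'), s') →
      ¬(pathPert φ₀ w P ((y, y'), s) = 0 ∧ pathPert φ₀ w P ((y, y'), s') = 0)} := by
  rw [Metric.dense_iff]
  intro P ε hε
  let F : C((Y × Y) × I, E) :=
    ⟨pathPert φ₀ w P, continuous_pathPert continuous_const continuous_id⟩
  obtain ⟨δ, hδ, hδε⟩ : ∃ δ > 0, 2 * δ ≤ c * ε := ⟨c * ε / 2, by positivity, by linarith⟩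
  have hU1 : IsOpen {z : Y × Y | ∀ t : Y × I, ‖F ((z.1, t.1), t.2) - F ((z.2, t.1), t.2)‖ < δ / 2} :=
    isOpen_forall_of_compactSpace (U := {a : (Y × Y) × (Y × I) |
      ‖F ((a.1.1, a.2.1), a.2.2) - F ((a.1.2, a.2.1), a.2.2)‖ < δ / 2})
      (isOpen_lt (by fun_prop) (by fun_prop))
  have hU2 : IsOpen {z : Y × Y | ∀ t : Y × I, ‖F ((t.1, z.1), t.2) - F ((t.1, z.2), t.2)‖ < δ / 2} :=
    isOpen_forall_of_compactSpace (U := {a : (Y × Y) × (Y × I) |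
      ‖F ((a.2.1, a.1.1), a.2.2) - F ((a.2.1, a.1.2), a.2.2)‖ < δ / 2})
      (isOpen_lt (by fun_prop) (by fun_prop))
  obtain ⟨N, φ, ι, hι, A, hA, hφ, hφU⟩ := hY _ (hU1.inter hU2)
    (fun y => ⟨by intro t; simpa using hδ, by intro t; simpa using hδ⟩)
  obtain ⟨Ψ, hΨ, hΨF⟩ := exists_contDiff_approx
    (θ := fun z : (Y × Y) × I => ((φ z.1.1, φ z.1.2), (z.2 : ℝ)))
    (by fun_prop) F.continuous (δ := δ) (by
      rintro ⟨⟨a, b⟩, s⟩ ⟨⟨a', b'⟩, s'⟩ h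
      simp only [Prod.mk.injEq] at h
      obtain ⟨⟨ha, hb⟩, hs⟩ := h
      obtain rfl : s = s' := Subtype.ext hs
      have h1 := (hφU a a' ha).1 (b, s)
      have h2 := (hφU b b' hb).2 (a', s)
      simp only at h1 h2
      have h3 := norm_sub_le_norm_sub_add_norm_sub (F ((a, b), s)) (F ((a', b), s))
        (F ((a', b'), s))
      linarith)
  obtain ⟨β, hβ0, hβ1, hβ⟩ := exists_continuous_zero_one_of_isClosed
    (hB₁.prod hB₀) (hB₀.prod hB₁) (by
      rw [Set.disjoint_left]
      exact fun z hz hz' => Set.disjoint_left.1 hB hz'.1 hz.1)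
  obtain ⟨ω, hω0, hω1, hω⟩ := exists_continuous_zero_one_of_isClosed hJ₀ hJ₁ hJ
  have hdense := dense_avoid (p := 2) (q := 2) (V := E × E) hA hφ
    (g := fun v => (-Ψ ((v.1 0, v.1 1), v.2 0), -Ψ ((v.1 0, v.1 1), v.2 1)))
    (by
      refine ContDiff.prodMk (ContDiff.neg (hΨ.comp ?_)) (ContDiff.neg (hΨ.comp ?_)) <;> fun_prop)
    (by rw [Module.finrank_prod]; omega)
  obtain ⟨⟨ζ₀, ζ₁⟩, hζ, hζδ⟩ := hdense.exists_mem_open (isOpen_ball (x := (0 : E × E)) (ε := δ))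
    ⟨0, mem_ball_self hδ⟩
  rw [mem_ball_zero_iff, Prod.norm_def, max_lt_iff] at hζδ
  let p : C((Y × Y) × I, E) := ⟨fun z => (1 - ω z.2) • ζ₀ + ω z.2 • ζ₁, by fun_prop⟩
  have hp : ∀ z, ‖p z‖ < δ := by
    intro z
    have h1 := hω z.2
    have h2 := (convex_ball (0 : E) δ) (mem_ball_zero_iff.2 hζδ.1) (mem_ball_zero_iff.2 hζδ.2)
      (sub_nonneg.2 h1.2) h1.1 (by ring)
    exact mem_ball_zero_iff.1 h2
  let F' : C((Y × Y) × I, E) := ⟨fun z => Ψ ((φ z.1.1, φ z.1.2), (z.2 : ℝ)) + p z, by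
    have := hΨ.continuous; fun_prop⟩
  have hF'F : ∀ z, ‖F' z - F z‖ < 2 * δ := by
    intro z
    have h1 := hΨF z
    have h2 := hp z
    calc ‖F' z - F z‖ = ‖(Ψ ((φ z.1.1, φ z.1.2), (z.2 : ℝ)) - F z) + p z‖ := by
          congr 1; simp only [F', ContinuousMap.coe_mk]; abel
      _ ≤ _ := norm_add_le _ _
      _ < 2 * δ := by linarith
  have hmax : ∀ z, 0 < max (w z) c := fun z => lt_max_of_lt_right hc
  let P' : C((Y × Y) × I, E) := ⟨fun z => P z + (β z.1 / max (w z) c) • (F' z - F z), by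
    refine P.continuous.add (Continuous.smul ?_ (by fun_prop))
    exact Continuous.div (by fun_prop) (by fun_prop) fun z => (hmax z).ne'⟩
  have hP' : ∀ y ∈ B₀, ∀ y' ∈ B₁, ∀ s, c ≤ w ((y, y'), s) →
      pathPert φ₀ w P' ((y, y'), s) = F' ((y, y'), s) := by
    intro y hy y' hy' s hs
    have h0 : β (y', y) = 0 := hβ0 ⟨hy', hy⟩
    have h1 : β (y, y') = 1 := hβ1 ⟨hy, hy'⟩
    have h2 : w ((y, y'), s) * (1 / w ((y, y'), s)) = 1 :=
      mul_one_div_cancel (hc.trans_le hs).ne'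
    have h3 : pathPert φ₀ w P' ((y, y'), s) = pathPert φ₀ w P ((y, y'), s) +
        (w ((y, y'), s) * (1 / w ((y, y'), s))) • (F' ((y, y'), s) - F ((y, y'), s)) := by
      simp only [pathPert, pathTwist, P', ContinuousMap.coe_mk, Prod.swap_prod_mk, h0, h1,
        max_eq_left hs, zero_div, zero_smul, add_zero]
      module
    rw [h3, h2, one_smul]
    simp [F]
  refine ⟨P', ?_, ?_⟩
  · rw [mem_ball, ContinuousMap.dist_lt_iff hε]
    intro z
    rw [dist_eq_norm]
    simp only [P', ContinuousMap.coe_mk, add_sub_cancel_left]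
    have hb := hβ z.1
    rw [norm_smul, Real.norm_of_nonneg (div_nonneg hb.1 (hmax z).le), div_mul_eq_mul_div,
      div_lt_iff₀ (hmax z)]
    have h1 := hF'F z
    have h2 : c * ε ≤ max (w z) c * ε := by gcongr; exact le_max_right _ _
    have h3 : β z.1 * ‖F' z - F z‖ ≤ 1 * ‖F' z - F z‖ := by gcongr; exact hb.2
    linarith
  · rintro y hy y' hy' s hs s' hs' hws hws' ⟨h1, h2⟩
    rw [hP' y hy y' hy' s hws] at h1
    rw [hP' y hy y' hy' s' hws'] at h2
    have e0 : ω s = 0 := hω0 hs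
    have e1 : ω s' = 1 := hω1 hs'
    simp only [F', p, ContinuousMap.coe_mk, e0, e1, sub_zero, one_smul, zero_smul, add_zero,
      sub_self, zero_add] at h1 h2
    refine hζ ![y, y'] ![(s : ℝ), (s' : ℝ)] (Prod.ext ?_ ?_)
    · simpa using (neg_eq_of_add_eq_zero_right h1).symm
    · simpa using (neg_eq_of_add_eq_zero_right h2).symm

theorem isOpen_pathPert_box (φ₀ : C((Y × Y) × I, E)) (w : C((Y × Y) × I, ℝ))
    {B₀ B₁ : Set Y} (hB₀ : IsClosed B₀) (hB₁ : IsClosed B₁)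
    {J₀ J₁ : Set I} (hJ₀ : IsClosed J₀) (hJ₁ : IsClosed J₁) (c : ℝ) :
    IsOpen {P : C((Y × Y) × I, E) | ∀ y ∈ B₀, ∀ y' ∈ B₁, ∀ s ∈ J₀, ∀ s' ∈ J₁,
      c ≤ w ((y, y'), s) → c ≤ w ((y, y'), s') →
      ¬(pathPert φ₀ w P ((y, y'), s) = 0 ∧ pathPert φ₀ w P ((y, y'), s') = 0)} := by
  let K : Set ((Y × Y) × I × I) := ((B₀ ×ˢ B₁) ×ˢ (J₀ ×ˢ J₁)) ∩
    ({q | c ≤ w (q.1, q.2.1)} ∩ {q | c ≤ w (q.1, q.2.2)})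
  have hK : IsCompact K := by
    refine IsClosed.isCompact (((hB₀.prod hB₁).prod (hJ₀.prod hJ₁)).inter (IsClosed.inter ?_ ?_))
    · exact isClosed_le (by fun_prop) (by fun_prop)
    · exact isClosed_le (by fun_prop) (by fun_prop)
  have := isOpen_forall_mem_of_isCompact hK
    (U := {a : C((Y × Y) × I, E) × ((Y × Y) × I × I) |
      ¬(pathPert φ₀ w a.1 (a.2.1, a.2.2.1) = 0 ∧ pathPert φ₀ w a.1 (a.2.1, a.2.2.2) = 0)}) ?_
  · convert this using 1
    ext P
    simp only [K, Set.mem_ofPred_eq, Set.mem_inter_iff, Set.mem_prod, Prod.forall, and_imp]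
    exact ⟨fun h y y' s s' hy hy' hs hs' => h y hy y' hy' s hs s' hs',
      fun h y hy y' hy' s hs s' hs' => h y y' s s' hy hy' hs hs'⟩
  · refine (IsClosed.inter (isClosed_eq ?_ continuous_const)
      (isClosed_eq ?_ continuous_const)).isOpen_compl
    · exact continuous_pathPert (by fun_prop) (by fun_prop)
    · exact continuous_pathPert (by fun_prop) (by fun_prop)
end PathPert

section PathPosition
variable {Y E : Type} [MetricSpace Y] [CompactSpace Y]
  [NormedAddCommGroup E] [NormedSpace ℝ E] [FiniteDimensional ℝ E] {d : ℕ}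

theorem exists_path_general_position (hY : DimProp Y d) (φ₀ : C((Y × Y) × I, E))
    (w : C((Y × Y) × I, ℝ)) (hd : d + 1 < Module.finrank ℝ E) :
    ∃ P : C((Y × Y) × I, E), (∀ z, ‖P z‖ < 1 / 4) ∧ ∀ y y' s s', y ≠ y' → s ≠ s' →
      0 < w ((y, y'), s) → 0 < w ((y, y'), s') →
      ¬(pathPert φ₀ w P ((y, y'), s) = 0 ∧ pathPert φ₀ w P ((y, y'), s') = 0) := by
  let O : Set ((Y × Y) × I × I) := {q | q.1.1 ≠ q.1.2 ∧ q.2.1 ≠ q.2.2 ∧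
    0 < w (q.1, q.2.1) ∧ 0 < w (q.1, q.2.2)}
  have hbox : ∀ q : (Y × Y) × I × I, ∃ (V : Set ((Y × Y) × I × I)) (S : Set C((Y × Y) × I, E)),
      IsOpen S ∧ Dense S ∧ (q ∈ O → V ∈ 𝓝 q) ∧ ∀ P ∈ S, ∀ r ∈ V,
        ¬(pathPert φ₀ w P (r.1, r.2.1) = 0 ∧ pathPert φ₀ w P (r.1, r.2.2) = 0) := by
    rintro ⟨⟨y, y'⟩, s, s'⟩
    by_cases hq : ((y, y'), s, s') ∈ O
    swap
    · exact ⟨∅, Set.univ, isOpen_univ, dense_univ, fun h => absurd h hq, by simp⟩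
    obtain ⟨h1, h2, h3, h4⟩ := hq
    simp only at h1 h2 h3 h4
    obtain ⟨B₀, hy₀, hB₀, B₁, hy₁, hB₁, hB⟩ := exists_open_nhds_disjoint_closure h1
    obtain ⟨J₀, hs₀, hJ₀, J₁, hs₁, hJ₁, hJ⟩ := exists_open_nhds_disjoint_closure h2
    obtain ⟨c, hc, hc1, hc2⟩ : ∃ c > 0, c < w ((y, y'), s) ∧ c < w ((y, y'), s') := by
      obtain ⟨c, hc0, hc⟩ := exists_between (lt_min h3 h4)
      exact ⟨c, hc0, lt_min_iff.1 hc⟩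
    refine ⟨((B₀ ×ˢ B₁) ×ˢ (J₀ ×ˢ J₁)) ∩ ({q | c < w (q.1, q.2.1)} ∩ {q | c < w (q.1, q.2.2)}), _,
      isOpen_pathPert_box φ₀ w isClosed_closure isClosed_closure isClosed_closure isClosed_closure c,
      dense_pathPert_box hY φ₀ w hd isClosed_closure isClosed_closure hB isClosed_closure
        isClosed_closure hJ hc, fun _ => ?_, ?_⟩
    · refine IsOpen.mem_nhds ?_ ⟨⟨⟨hy₀, hy₁⟩, hs₀, hs₁⟩, hc1, hc2⟩
      refine ((hB₀.prod hB₁).prod (hJ₀.prod hJ₁)).inter (IsOpen.inter ?_ ?_)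
      · exact isOpen_lt (by fun_prop) (by fun_prop)
      · exact isOpen_lt (by fun_prop) (by fun_prop)
    · rintro P hP ⟨⟨a, a'⟩, t, t'⟩ ⟨⟨⟨ha, ha'⟩, ht, ht'⟩, hw, hw'⟩
      exact hP a (subset_closure ha) a' (subset_closure ha') t (subset_closure ht) t'
        (subset_closure ht') hw.le hw'.le
  choose V S hSo hSd hV hVS using hbox
  obtain ⟨T, hTO, hTc, hT⟩ := TopologicalSpace.countable_cover_nhdsWithin (f := V) (s := O)
    fun q hq => mem_nhdsWithin_of_mem_nhds (hV q hq)
  have hdense := dense_biInter_of_isOpen (f := S) (S := T) (fun q _ => hSo q) hTc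
    (fun q _ => hSd q)
  obtain ⟨P, hPb, hP⟩ := hdense.exists_mem_open
    (isOpen_ball (x := (0 : C((Y × Y) × I, E))) (ε := 1 / 4)) ⟨0, mem_ball_self (by norm_num)⟩
  refine ⟨P, fun z => ?_, fun y y' s s' h1 h2 h3 h4 => ?_⟩
  · rw [mem_ball_zero_iff] at hP
    exact (P.norm_coe_le_norm z).trans_lt hP
  · obtain ⟨q, hq, hqV⟩ := Set.mem_iUnion₂.1 (hT (show ((y, y'), s, s') ∈ O from ⟨h1, h2, h3, h4⟩))
    exact hVS q P (Set.mem_iInter₂.1 hPb q hq) _ hqV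
end PathPosition

theorem exists_linear_splitting {M : ℕ} {v : EuclideanSpace ℝ (Fin (M + 1))} (hv : v ≠ 0) :
    ∃ (e : EuclideanSpace ℝ (Fin (M + 1)) →L[ℝ] ℝ)
      (p : EuclideanSpace ℝ (Fin (M + 1)) →L[ℝ] EuclideanSpace ℝ (Fin M)),
      e v = 1 ∧ p v = 0 ∧ ∀ x, e x = 0 → p x = 0 → x = 0 := by
  obtain ⟨e, he⟩ := SeparatingDual.exists_eq_one (R := ℝ) hv
  let W := Submodule.span ℝ {v}
  have hfin : Module.finrank ℝ (EuclideanSpace ℝ (Fin (M + 1)) ⧸ W) =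
      Module.finrank ℝ (EuclideanSpace ℝ (Fin M)) := by
    have h1 := W.finrank_quotient_add_finrank
    rw [finrank_span_singleton hv, finrank_euclideanSpace_fin] at h1
    rw [finrank_euclideanSpace_fin]
    omega
  let L := LinearEquiv.ofFinrankEq _ _ hfin
  refine ⟨e, LinearMap.toContinuousLinearMap (L.toLinearMap ∘ₗ W.mkQ), he, ?_, fun x hx hpx => ?_⟩
  · simpa [W] using Submodule.mem_span_singleton_self v
  · have h1 : x ∈ W := by simpa using hpx
    obtain ⟨c, rfl⟩ := Submodule.mem_span_singleton.1 h1
    have : c = 0 := by simpa [he] using hx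
    simp [this]

theorem IsOddSep.desuspend {Y : Type} [MetricSpace Y] [CompactSpace Y] {d M : ℕ}
    (hY : DimProp Y d) (hd : d + 1 < M)
    {Φ : C(Susp Y × Susp Y, EuclideanSpace ℝ (Fin (M + 1)))} (hΦ : IsOddSep Φ) :
    ∃ F : C(Y × Y, EuclideanSpace ℝ (Fin M)), IsOddSep F := by
  rcases isEmpty_or_nonempty Y with hE | ⟨⟨y₀⟩⟩
  · exact ⟨0, isEmptyElim, isEmptyElim⟩
  let μ : C((Y × Y) × I, Susp Y × Susp Y) :=
    ⟨fun z => (suspMk (z.1.1, z.2), suspMk (z.1.2, σ z.2)), by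
      refine (continuous_suspMk.comp (by fun_prop)).prodMk (continuous_suspMk.comp ?_)
      exact (by fun_prop : Continuous fun z : (Y × Y) × I => z.1.2).prodMk
        (unitInterval.continuous_symm.comp continuous_snd)⟩
  have hμne : ∀ y y' s, y ≠ y' → Φ (μ ((y, y'), s)) ≠ 0 := by
    intro y y' s hne h0
    rcases suspMk_eq_iff.1 (hΦ.2 _ _ h0) with h | ⟨h, h'⟩ | ⟨h, h'⟩
    · exact hne (congrArg Prod.fst h)
    · simp only at h h'
      subst h
      exact uiZeroNeOne (by simpa using h'.symm)
    · simp only at h h'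
      subst h
      simp at h'
  have hμtw : ∀ z, Φ (μ (pathTwist z)) = - Φ (μ z) := by
    intro z
    simp only [μ, ContinuousMap.coe_mk, pathTwist, Prod.fst_swap, Prod.snd_swap,
      unitInterval.symm_symm]
    exact hΦ.1 _ _
  let v := Φ (μ ((y₀, y₀), 1))
  have hv1 : ∀ y y', Φ (μ ((y, y'), 1)) = v := by
    intro y y'
    have h1 : suspMk (y, (1 : I)) = suspMk (y₀, 1) := suspMk_eq_iff.2 (Or.inr (Or.inr ⟨rfl, rfl⟩))
    have h2 : suspMk (y', (0 : I)) = suspMk (y₀, 0) := suspMk_eq_iff.2 (Or.inr (Or.inl ⟨rfl, rfl⟩))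
    simp [v, μ, h1, h2]
  have hv0 : ∀ y y', Φ (μ ((y, y'), 0)) = -v := by
    intro y y'
    rw [← hv1 y' y, ← hμtw]
    simp [pathTwist]
  have hv : v ≠ 0 := by
    intro h0
    rcases suspMk_eq_iff.1 (hΦ.2 _ _ h0) with h | ⟨h, h'⟩ | ⟨h, h'⟩
    · exact uiZeroNeOne (by simpa using (congrArg Prod.snd h).symm)
    · exact uiZeroNeOne h.symm
    · simp at h'
  obtain ⟨e, p, hev, hpv, hep⟩ := exists_linear_splitting hv
  let φe : C((Y × Y) × I, ℝ) := ⟨fun z => e (Φ (μ z)), by fun_prop⟩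
  let φ₀ : C((Y × Y) × I, EuclideanSpace ℝ (Fin M)) := ⟨fun z => p (Φ (μ z)), by fun_prop⟩
  let w : C((Y × Y) × I, ℝ) := ⟨fun z => (‖φ₀ z‖ + |φe z|) * (z.2 * (1 - z.2)), by fun_prop⟩
  have hφne : ∀ y y' s, y ≠ y' → 0 < ‖φ₀ ((y, y'), s)‖ + |φe ((y, y'), s)| := by
    intro y y' s hne
    by_contra hcon
    have h1 := norm_nonneg (φ₀ ((y, y'), s))
    have h2 := abs_nonneg (φe ((y, y'), s))
    exact hμne y y' s hne (hep _ (abs_eq_zero.1 (by linarith : |φe ((y, y'), s)| = 0))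
      (norm_eq_zero.1 (by linarith : ‖φ₀ ((y, y'), s)‖ = 0)))
  have hsle : ∀ s : I, (0 : ℝ) ≤ s * (1 - s) ∧ (s : ℝ) * (1 - s) ≤ 1 := fun s =>
    ⟨mul_nonneg s.2.1 (sub_nonneg.2 s.2.2), by nlinarith [s.2.1, s.2.2]⟩
  obtain ⟨P, hP, hPg⟩ := exists_path_general_position hY φ₀ w (by simpa using hd)
  let φ₁ : C((Y × Y) × I, EuclideanSpace ℝ (Fin M)) :=
    ⟨pathPert φ₀ w P, continuous_pathPert continuous_const continuous_id⟩
  have htwe : ∀ z, φe (pathTwist z) = - φe z := fun z => by simp [φe, hμtw]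
  have htw₀ : ∀ z, φ₀ (pathTwist z) = - φ₀ z := fun z => by simp [φ₀, hμtw]
  have htww : ∀ z, w (pathTwist z) = w z := fun z => by
    simp only [w, ContinuousMap.coe_mk, htw₀, htwe, norm_neg, abs_neg]
    simp [pathTwist]
    ring_nf
    tauto
  have htw₁ : ∀ z, φ₁ (pathTwist z) = - φ₁ z := fun z => by
    have : pathTwist (pathTwist z) = z := by simp [pathTwist]
    simp only [φ₁, ContinuousMap.coe_mk, pathPert, htww, htw₀, this]
    module
  have hne₁ : ∀ y y' s, y ≠ y' → φ₁ ((y, y'), s) = 0 → φe ((y, y'), s) ≠ 0 := by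
    intro y y' s hne h1 h0
    have h2 := hφne y y' s hne
    rw [h0, abs_zero, add_zero] at h2
    have h3 : φ₀ ((y, y'), s) =
        -(w ((y, y'), s) • (P ((y, y'), s) - P (pathTwist ((y, y'), s)))) :=
      eq_neg_of_add_eq_zero_left h1
    have h4 : w ((y, y'), s) ≤ ‖φ₀ ((y, y'), s)‖ := by
      simp only [w, ContinuousMap.coe_mk, h0, abs_zero, add_zero]
      exact mul_le_of_le_one_right (norm_nonneg _) (hsle s).2
    have h5 : 0 ≤ w ((y, y'), s) := mul_nonneg (by positivity) (hsle s).1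
    have h6 := congrArg norm h3
    rw [norm_neg, norm_smul, Real.norm_of_nonneg h5] at h6
    have h7 : ‖P ((y, y'), s) - P (pathTwist ((y, y'), s))‖ ≤ 1 / 2 := by
      linarith [norm_sub_le (P ((y, y'), s)) (P (pathTwist ((y, y'), s))), hP ((y, y'), s),
        hP (pathTwist ((y, y'), s))]
    nlinarith
  have hz0 : ∀ y y', φ₁ ((y, y'), 0) = 0 ∧ φe ((y, y'), 0) = -1 := fun y y' => by
    simp [φ₁, φ₀, φe, pathPert, w, hv0, hpv, hev]
  have hz1 : ∀ y y', φ₁ ((y, y'), 1) = 0 ∧ φe ((y, y'), 1) = 1 := fun y y' => by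
    simp [φ₁, φ₀, φe, pathPert, w, hv1, hpv, hev]
  let T : {z : Y × Y // z.1 ≠ z.2} → Set ℝ := fun z => {u | ∀ s : I, φ₁ (z.1, s) = 0 →
    (φe (z.1, s) ≤ 0 → s < u) ∧ (0 ≤ φe (z.1, s) → u < s)}
  have hTc : ∀ z, Convex ℝ (T z) := by
    intro z u hu u' hu' a b ha hb hab s hs
    have h1 := hu s hs
    have h2 := hu' s hs
    exact ⟨fun h => (convex_Ioi (s : ℝ)) (h1.1 h) (h2.1 h) ha hb hab,
      fun h => (convex_Iio (s : ℝ)) (h1.2 h) (h2.2 h) ha hb hab⟩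
  have hTne : ∀ z, (T z).Nonempty := by
    rintro ⟨⟨y, y'⟩, hne⟩
    have hw : ∀ s : I, s ≠ 0 → s ≠ 1 → 0 < w ((y, y'), s) := fun s h0 h1 =>
      mul_pos (hφne y y' s hne) (mul_pos (unitInterval.pos_iff_ne_zero.2 h0)
        (sub_pos.2 (unitInterval.lt_one_iff_ne_one.2 h1)))
    have hcase : ∀ {a b : ℝ}, a < b → 0 ≤ a → b ≤ 1 →
        (∀ s : I, s ≠ 0 → s ≠ 1 → φ₁ ((y, y'), s) = 0 →
          (φe ((y, y'), s) < 0 ∧ (s : ℝ) ≤ a) ∨ (0 < φe ((y, y'), s) ∧ b ≤ (s : ℝ))) →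
        (T ⟨(y, y'), hne⟩).Nonempty := by
      intro a b hab ha hb h
      refine ⟨(a + b) / 2, fun s hs => ?_⟩
      simp only at hs ⊢
      by_cases h0 : s = 0
      · subst h0
        rw [(hz0 y y').2]
        exact ⟨fun _ => by simp only [Set.Icc.coe_zero]; linarith, fun h => by linarith⟩
      by_cases h1 : s = 1
      · subst h1
        rw [(hz1 y y').2]
        exact ⟨fun h => by linarith, fun _ => by simp only [Set.Icc.coe_one]; linarith⟩
      rcases h s h0 h1 hs with ⟨h2, h3⟩ | ⟨h2, h3⟩
      · exact ⟨fun _ => by linarith, fun h => by linarith⟩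
      · exact ⟨fun h => by linarith, fun _ => by linarith⟩
    by_cases hs : ∃ s : I, s ≠ 0 ∧ s ≠ 1 ∧ φ₁ ((y, y'), s) = 0
    · obtain ⟨s, h0, h1, hs⟩ := hs
      have huniq : ∀ s' : I, s' ≠ 0 → s' ≠ 1 → φ₁ ((y, y'), s') = 0 → s' = s := by
        intro s' h0' h1' hs'
        by_contra hss
        exact hPg y y' s' s hne hss (hw s' h0' h1') (hw s h0 h1) ⟨hs', hs⟩
      rcases lt_or_gt_of_ne (hne₁ y y' s hne hs) with h | h
      · refine hcase (unitInterval.lt_one_iff_ne_one.2 h1) s.2.1 le_rfl fun s' h0' h1' hs' => ?_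
        obtain rfl := huniq s' h0' h1' hs'
        exact Or.inl ⟨h, le_rfl⟩
      · refine hcase (unitInterval.pos_iff_ne_zero.2 h0) le_rfl s.2.2 fun s' h0' h1' hs' => ?_
        obtain rfl := huniq s' h0' h1' hs'
        exact Or.inr ⟨h, le_rfl⟩
    · push Not at hs
      exact hcase zero_lt_one le_rfl le_rfl fun s h0 h1 h => absurd h (hs s h0 h1)
  have hTloc : ∀ z, ∃ u, ∀ᶠ z' in 𝓝 z, u ∈ T z' := by
    intro z
    obtain ⟨u, hu⟩ := hTne z
    refine ⟨u, ?_⟩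
    have hopen := isOpen_forall_of_compactSpace (A := {z : Y × Y // z.1 ≠ z.2}) (B := I)
      (U := {a | φ₁ (a.1.1, a.2) = 0 → (φe (a.1.1, a.2) ≤ 0 → a.2 < u) ∧
        (0 ≤ φe (a.1.1, a.2) → u < a.2)}) (by
      have h1 : IsOpen {a : {z : Y × Y // z.1 ≠ z.2} × I | φ₁ (a.1.1, a.2) ≠ 0} :=
        isOpen_ne_fun (by fun_prop) continuous_const
      have h2 : IsOpen {a : {z : Y × Y // z.1 ≠ z.2} × I | 0 < φe (a.1.1, a.2)} :=
        isOpen_lt continuous_const (by fun_prop)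
      have h3 : IsOpen {a : {z : Y × Y // z.1 ≠ z.2} × I | φe (a.1.1, a.2) < 0} :=
        isOpen_lt (by fun_prop) continuous_const
      have h4 : IsOpen {a : {z : Y × Y // z.1 ≠ z.2} × I | (a.2 : ℝ) < u} :=
        isOpen_lt (by fun_prop) continuous_const
      have h5 : IsOpen {a : {z : Y × Y // z.1 ≠ z.2} × I | u < (a.2 : ℝ)} :=
        isOpen_lt continuous_const (by fun_prop)
      convert h1.union ((h2.union h4).inter (h3.union h5)) using 1
      ext a
      simp only [Set.mem_ofPred_eq, Set.mem_union, Set.mem_inter_iff, ← not_lt]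
      tauto)
    exact hopen.mem_nhds hu
  obtain ⟨h, hh⟩ := exists_continuous_forall_mem_convex_of_local_const hTc hTloc
  have hTmem : ∀ z, ∀ u ∈ T z, u ∈ I := fun z u hu =>
    ⟨((hu 0 (hz0 _ _).1).1 (by rw [(hz0 _ _).2]; norm_num)).le,
      ((hu 1 (hz1 _ _).1).2 (by rw [(hz1 _ _).2]; norm_num)).le⟩
  have hTsymm : ∀ (z : {z : Y × Y // z.1 ≠ z.2}) (u : ℝ), u ∈ T ⟨z.1.swap, z.2.symm⟩ →
      1 - u ∈ T z := by
    intro z u hu s hs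
    have h1 := hu (σ s) (by
      have := htw₁ (z.1, s)
      rw [hs, neg_zero] at this
      exact this)
    have h2 : φe (z.1.swap, σ s) = - φe (z.1, s) := htwe (z.1, s)
    simp only [h2, unitInterval.coe_symm_eq] at h1
    exact ⟨fun h => by linarith [h1.2 (by linarith)], fun h => by linarith [h1.1 (by linarith)]⟩
  let swp : C({z : Y × Y // z.1 ≠ z.2}, {z : Y × Y // z.1 ≠ z.2}) :=
    ⟨fun z => ⟨z.1.swap, z.2.symm⟩, by
      exact (continuous_swap.comp continuous_subtype_val).subtype_mk _⟩
  let k : C({z : Y × Y // z.1 ≠ z.2}, ℝ) := ⟨fun z => (1 / 2) * h z + (1 / 2) * (1 - h (swp z)), by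
    fun_prop⟩
  have hk : ∀ z, k z ∈ T z := fun z =>
    hTc z (hh z) (hTsymm z _ (hh (swp z))) (by norm_num) (by norm_num) (by norm_num)
  have hks : ∀ z, k (swp z) = 1 - k z := fun z => by
    have : swp (swp z) = z := by simp [swp]
    simp only [k, ContinuousMap.coe_mk, this]
    ring
  let κ : {z : Y × Y // z.1 ≠ z.2} → I := fun z => ⟨k z, hTmem z _ (hk z)⟩
  have hκ : Continuous κ := k.continuous.subtype_mk _
  have hκs : ∀ z, κ (swp z) = σ (κ z) := fun z => Subtype.ext (hks z)
  have hκne : ∀ z, φ₁ (z.1, κ z) ≠ 0 := by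
    intro z h0
    have h1 := hk z (κ z) h0
    rcases le_total (φe (z.1, κ z)) 0 with h2 | h2
    · exact lt_irrefl _ (h1.1 h2)
    · exact lt_irrefl _ (h1.2 h2)
  classical
  let F : Y × Y → EuclideanSpace ℝ (Fin M) := fun z =>
    if hz : z.1 ≠ z.2 then dist z.1 z.2 • φ₁ (z, κ ⟨z, hz⟩) else 0
  have hF : Continuous F := by
    rw [continuous_iff_continuousAt]
    intro z
    by_cases hz : z.1 ≠ z.2
    · have hopen : IsOpen {z : Y × Y | z.1 ≠ z.2} := isOpen_ne_fun continuous_fst continuous_snd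
      refine ContinuousOn.continuousAt (s := {z : Y × Y | z.1 ≠ z.2}) ?_ (hopen.mem_nhds hz)
      rw [continuousOn_iff_continuous_domRestrict]
      have : ({z : Y × Y | z.1 ≠ z.2}.domRestrict F) = fun z : {z : Y × Y // z.1 ≠ z.2} =>
          dist z.1.1 z.1.2 • φ₁ (z.1, κ z) := by
        funext z
        exact dif_pos z.2
      rw [this]
      fun_prop
    · have hFz : F z = 0 := dif_neg hz
      push Not at hz
      rw [ContinuousAt, hFz]
      refine squeeze_zero_norm (a := fun z => dist z.1 z.2 * ‖φ₁‖) ?_ ?_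
      · intro z'
        by_cases hz' : z'.1 ≠ z'.2
        · rw [show F z' = dist z'.1 z'.2 • φ₁ (z', κ ⟨z', hz'⟩) from dif_pos hz', norm_smul,
            Real.norm_of_nonneg dist_nonneg]
          gcongr
          exact φ₁.norm_coe_le_norm _
        · rw [show F z' = 0 from dif_neg hz', norm_zero]
          positivity
      · have : Continuous fun z : Y × Y => dist z.1 z.2 * ‖φ₁‖ := by fun_prop
        simpa [hz] using this.tendsto z
  refine ⟨⟨F, hF⟩, fun y y' => ?_, fun y y' h0 => ?_⟩
  · by_cases hne : y = y'
    · subst hne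
      simp [F]
    · have h1 : F (y', y) = dist y' y • φ₁ ((y', y), κ (swp ⟨(y, y'), hne⟩)) :=
        dif_pos (Ne.symm hne)
      have h2 : F (y, y') = dist y y' • φ₁ ((y, y'), κ ⟨(y, y'), hne⟩) := dif_pos hne
      have h3 : φ₁ ((y', y), σ (κ ⟨(y, y'), hne⟩)) = - φ₁ ((y, y'), κ ⟨(y, y'), hne⟩) :=
        htw₁ ((y, y'), κ ⟨(y, y'), hne⟩)
      simp only [ContinuousMap.coe_mk]
      rw [h1, h2, hκs, h3, smul_neg, dist_comm]
  · by_contra hne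
    have h2 : F (y, y') = dist y y' • φ₁ ((y, y'), κ ⟨(y, y'), hne⟩) := dif_pos hne
    rw [ContinuousMap.coe_mk, h2, smul_eq_zero] at h0
    exact h0.elim (dist_ne_zero.2 hne) (hκne ⟨(y, y'), hne⟩)

instance compactSpace_suspN {X : Type} [TopologicalSpace X] [CompactSpace X] :
    ∀ k : ℕ, CompactSpace (SuspN X k)
  | 0 => inferInstanceAs (CompactSpace X)
  | k + 1 =>
    haveI := compactSpace_suspN (X := X) k
    inferInstanceAs (CompactSpace (Susp (SuspN X k)))

theorem exists_isEmbedding_susp {Y : Type} [TopologicalSpace Y] [CompactSpace Y] {M : ℕ}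
    {f : Y → EuclideanSpace ℝ (Fin M)} (hf : IsEmbedding f) :
    ∃ g : Susp Y → EuclideanSpace ℝ (Fin (M + 1)), IsEmbedding g := by
  have hfc := hf.continuous
  let G : C(Y × I, EuclideanSpace ℝ (Fin M) × ℝ) :=
    ⟨fun z => (suspWeight z.2 • f z.1, 2 * (z.2 : ℝ) - 1), by
      have := continuous_suspWeight
      fun_prop⟩
  let g := suspLift G (by
    rintro ⟨y, s⟩ ⟨y', s'⟩ (h | ⟨h, h'⟩ | ⟨h, h'⟩)
    · rw [h]
    · simp only at h h'
      simp [G, h, h']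
    · simp only at h h'
      simp [G, h, h'])
  have hg : Function.Injective g := by
    intro a b hab
    obtain ⟨⟨y, s⟩, rfl⟩ := suspMk_surjective a
    obtain ⟨⟨y', s'⟩, rfl⟩ := suspMk_surjective b
    simp only [g, suspLift_mk] at hab
    simp only [G, ContinuousMap.coe_mk, Prod.mk.injEq] at hab
    obtain ⟨h1, h2⟩ := hab
    obtain rfl : s = s' := Subtype.ext (by linarith)
    apply suspMk_eq_iff.2
    by_cases hw : suspWeight s = 0
    · rcases suspWeight_eq_zero hw with h | h
      · exact Or.inr (Or.inl ⟨h, h⟩)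
      · exact Or.inr (Or.inr ⟨h, h⟩)
    · rw [hf.injective (smul_right_injective _ hw h1)]
      exact Or.inl rfl
  let L : (EuclideanSpace ℝ (Fin M) × ℝ) ≃L[ℝ] EuclideanSpace ℝ (Fin (M + 1)) :=
    ContinuousLinearEquiv.ofFinrankEq (by simp)
  exact ⟨L ∘ g, ((L.continuous.comp g.continuous).isClosedEmbedding
    (L.injective.comp hg)).isEmbedding⟩

theorem exists_isEmbedding_suspN {X : Type} [TopologicalSpace X] [CompactSpace X] {m : ℕ}
    (h : ∃ f : X → EuclideanSpace ℝ (Fin m), IsEmbedding f) :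
    ∀ k, ∃ f : SuspN X k → EuclideanSpace ℝ (Fin (m + k)), IsEmbedding f
  | 0 => h
  | k + 1 => by
    obtain ⟨f, hf⟩ := exists_isEmbedding_suspN h k
    exact exists_isEmbedding_susp hf

theorem dimProp_suspN {X : Type} [TopologicalSpace X] {n : ℕ} (h : DimProp X n) :
    ∀ k, DimProp (SuspN X k) (n + k)
  | 0 => h
  | k + 1 => dimProp_susp (dimProp_suspN h k)

theorem isEmbedding_suspMk_half {Y : Type} [TopologicalSpace Y] [CompactSpace Y]
    [T2Space (Susp Y)] : IsEmbedding fun y : Y => suspMk (y, (⟨1 / 2, by norm_num, by norm_num⟩ : I)) := by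
  have hc : Continuous fun y : Y => suspMk (y, (⟨1 / 2, by norm_num, by norm_num⟩ : I)) :=
    continuous_suspMk.comp (by fun_prop)
  refine (hc.isClosedEmbedding fun y y' h => ?_).isEmbedding
  rcases suspMk_eq_iff.1 h with h | ⟨h, -⟩ | ⟨h, -⟩
  · exact congrArg Prod.fst h
  · exact absurd (congrArg Subtype.val h) (by norm_num)
  · exact absurd (congrArg Subtype.val h) (by norm_num)

theorem exists_isOddSep_of_suspN {X : Type} [MetricSpace X] [CompactSpace X] {n m : ℕ}
    (hX : DimProp X n) (hm : n + 1 < m) : ∀ k, TopologicalSpace.MetrizableSpace (SuspN X k) →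
      (∃ Φ : C(SuspN X k × SuspN X k, EuclideanSpace ℝ (Fin (m + k))), IsOddSep Φ) →
      ∃ F : C(X × X, EuclideanSpace ℝ (Fin m)), IsOddSep F
  | 0 => fun _ h => h
  | k + 1 => by
    rintro hmet ⟨Φ, hΦ⟩
    have hmet' : TopologicalSpace.MetrizableSpace (Susp (SuspN X k)) := hmet
    have hY : TopologicalSpace.MetrizableSpace (SuspN X k) :=
      (isEmbedding_suspMk_half (Y := SuspN X k)).metrizableSpace
    refine exists_isOddSep_of_suspN hX hm k hY ?_
    let := TopologicalSpace.metrizableSpaceMetric (SuspN X k)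
    exact IsOddSep.desuspend (dimProp_suspN hX k) (by omega) hΦ

/-- Corollary 4.4, (i) ⟺ (ii): for `k > 0` and `2m > 3(n+1)`, an `n`-dimensional
compactum `X` embeds in `ℝ^m` iff `Σ^k X` embeds in `ℝ^{m+k}`. -/
theorem stmt13 (n m k : ℕ) (hk : 0 < k) (hm : 2 * m > 3 * (n + 1))
    (X : Type) [MetricSpace X] [CompactSpace X] (hdim : CoveringDimLE X n) :
    (∃ f : X → EuclideanSpace ℝ (Fin m), IsEmbedding f) ↔
    (∃ f : SuspN X k → EuclideanSpace ℝ (Fin (m + k)), IsEmbedding f) := by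
  refine ⟨fun h => exists_isEmbedding_suspN h k, ?_⟩
  rintro ⟨f, hf⟩
  have hX := dimProp_of_coveringDimLE hdim
  obtain ⟨F, hF⟩ := exists_isOddSep_of_suspN (m := m) hX (by omega) k hf.metrizableSpace
    ⟨diffMap ⟨f, hf.continuous⟩, diffMap_odd _, fun x y h => hf.injective (sub_eq_zero.1 h)⟩
  obtain ⟨g, hg⟩ := exists_injective_of_isOddSep hX hm hF
  exact ⟨g, (g.continuous.isClosedEmbedding hg).isEmbedding⟩
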